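/- arXiv:1905.12397 — 2 statements merged into one kernel-verified Lean document; each statement's English description precedes it below -/
import Mathlib

section
/- Let Σ₁ = (A₁,B₁,C₁,D₁;X₁,U,Y;κ) and Σ₂ = (A₂,B₂,C₂,D₂;X₂,U,Y;κ) be two minimal passive systems with the same Hilbert incoming space U and outgoing space Y and with Pontryagin state spaces of the same negative index κ, and suppose their transfer functions coincide on a neighborhood of 0 (equivalently, D₁ = D₂ and C₁A₁ⁿB₁ = C₂A₂ⁿB₂ for all integers n ≥ 0). Then Σ₁ and Σ₂ are weakly similar: there exists an injective, closed, densely defined linear operator Z from X₁ to X₂ with dense range such that for every f ∈ dom Z one has A₁f ∈ dom Z, ZA₁f = A₂Zf and C₁f = C₂Zf, and ran B₁ ⊆ dom Z with ZB₁u = B₂u for all u ∈ U. -/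
open MeasureTheory ContinuousLinearMap Filter Topology Metric
open scoped ComplexConjugate

noncomputable section

notation "⟪" x ", " y "⟫" => @inner ℂ _ _ x y

namespace Pontryagin

variable {X X' U Y : Type*}

section Ops

variable [NormedAddCommGroup X] [InnerProductSpace ℂ X] [CompleteSpace X]
  [NormedAddCommGroup X'] [InnerProductSpace ℂ X'] [CompleteSpace X']
  [NormedAddCommGroup U] [InnerProductSpace ℂ U] [CompleteSpace U]
  [NormedAddCommGroup Y] [InnerProductSpace ℂ Y] [CompleteSpace Y]

/-- `J` is a fundamental symmetry of negative index `κ`: a self-adjoint unitary whose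
eigenspace for `-1` (i.e. `ker (J + I)`) has dimension `κ`. -/
def IsFundamentalSymmetry (J : X →L[ℂ] X) (κ : ℕ) : Prop :=
  IsSelfAdjoint J ∧ J ∘L J = ContinuousLinearMap.id ℂ X ∧
    Module.finrank ℂ (LinearMap.ker ((J : X →ₗ[ℂ] X) + LinearMap.id)) = κ

/-- indefinite adjoint `T^[*] = J_X T* J_Y` of `T : X →L Y`. -/
def iadj (JX : X →L[ℂ] X) (JY : Y →L[ℂ] Y) (T : X →L[ℂ] Y) : Y →L[ℂ] X :=
  JX ∘L (ContinuousLinearMap.adjoint T) ∘L JY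

/-- the controllable subspace `X^c`. -/
def ctrlSpace (A : X →L[ℂ] X) (B : U →L[ℂ] X) : Submodule ℂ X :=
  (⨆ n : ℕ, LinearMap.range (((A ^ n) ∘L B) : U →ₗ[ℂ] X)).topologicalClosure

/-- the observable subspace `X^o`. -/
def obsSpace (JX : X →L[ℂ] X) (A : X →L[ℂ] X) (C : X →L[ℂ] Y) : Submodule ℂ X :=
  ctrlSpace (iadj JX JX A) (JX ∘L ContinuousLinearMap.adjoint C)

/-- the simple subspace `X^s`. -/
def simpleSpace (JX : X →L[ℂ] X) (A : X →L[ℂ] X) (B : U →L[ℂ] X) (C : X →L[ℂ] Y) :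
    Submodule ℂ X :=
  (ctrlSpace A B ⊔ obsSpace JX A C).topologicalClosure

/-- the `[·,·]`-orthogonal companion `M^[⊥]` of `M`. -/
def iOrtho (JX : X →L[ℂ] X) (M : Submodule ℂ X) : Submodule ℂ X :=
  Submodule.comap (JX : X →ₗ[ℂ] X) Mᗮ

/-- `M` is a Hilbert subspace: closed and positive definite for `[·,·]`. -/
def IsHilbertSubspace (JX : X →L[ℂ] X) (M : Submodule ℂ X) : Prop :=
  IsClosed (M : Set X) ∧ ∀ x ∈ M, x ≠ 0 → 0 < (⟪JX x, x⟫).re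

/-- `M` is an anti-Hilbert subspace: closed and negative definite for `[·,·]`. -/
def IsAntiHilbertSubspace (JX : X →L[ℂ] X) (M : Submodule ℂ X) : Prop :=
  IsClosed (M : Set X) ∧ ∀ x ∈ M, x ≠ 0 → (⟪JX x, x⟫).re < 0

/-- a fundamental decomposition `X = P ∔ M`. -/
def IsFundDecomp (JX : X →L[ℂ] X) (P M : Submodule ℂ X) : Prop :=
  IsHilbertSubspace JX P ∧ IsAntiHilbertSubspace JX M ∧
    (∀ x ∈ P, ∀ y ∈ M, ⟪JX x, y⟫ = 0) ∧ P ⊓ M = ⊥ ∧ P ⊔ M = ⊤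

/-- passivity: the system operator is a contraction for the indefinite metrics. -/
def IsPassive (JX : X →L[ℂ] X) (A : X →L[ℂ] X) (B : U →L[ℂ] X) (C : X →L[ℂ] Y)
    (D : U →L[ℂ] Y) : Prop :=
  ∀ (x : X) (u : U),
    (⟪JX (A x + B u), A x + B u⟫).re + ‖C x + D u‖ ^ 2 ≤ (⟪JX x, x⟫).re + ‖u‖ ^ 2

/-- the system operator is isometric: `T^[*] T = I`. -/
def IsIsometricSys (JX : X →L[ℂ] X) (A : X →L[ℂ] X) (B : U →L[ℂ] X) (C : X →L[ℂ] Y)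
    (D : U →L[ℂ] Y) : Prop :=
  ∀ (x x' : X) (u u' : U),
    ⟪JX (A x + B u), A x' + B u'⟫ + ⟪C x + D u, C x' + D u'⟫ = ⟪JX x, x'⟫ + ⟪u, u'⟫

/-- the system operator is co-isometric: `T T^[*] = I`, i.e. `T^[*]` is isometric. -/
def IsCoisometricSys (JX : X →L[ℂ] X) (A : X →L[ℂ] X) (B : U →L[ℂ] X) (C : X →L[ℂ] Y)
    (D : U →L[ℂ] Y) : Prop :=
  ∀ (x x' : X) (y y' : Y),
    ⟪JX (iadj JX JX A x + (JX ∘L ContinuousLinearMap.adjoint C) y),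
        iadj JX JX A x' + (JX ∘L ContinuousLinearMap.adjoint C) y'⟫
      + ⟪(ContinuousLinearMap.adjoint B ∘L JX) x + ContinuousLinearMap.adjoint D y,
          (ContinuousLinearMap.adjoint B ∘L JX) x' + ContinuousLinearMap.adjoint D y'⟫
      = ⟪JX x, x'⟫ + ⟪y, y'⟫

def IsConservativeSys (JX : X →L[ℂ] X) (A : X →L[ℂ] X) (B : U →L[ℂ] X) (C : X →L[ℂ] Y)
    (D : U →L[ℂ] Y) : Prop :=
  IsIsometricSys JX A B C D ∧ IsCoisometricSys JX A B C D

/-- the value `D + z C (I - zA)⁻¹ B` of the transfer function. -/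
def transferAt (A : X →L[ℂ] X) (B : U →L[ℂ] X) (C : X →L[ℂ] Y) (D : U →L[ℂ] Y)
    (z : ℂ) : U →L[ℂ] Y :=
  D + z • (C ∘L (Ring.inverse ((1 : X →L[ℂ] X) - z • A)) ∘L B)

/-- the system realizes `θ` (in a neighbourhood of the origin). -/
def IsRealizationOf (A : X →L[ℂ] X) (B : U →L[ℂ] X) (C : X →L[ℂ] Y) (D : U →L[ℂ] Y)
    (θ : ℂ → (U →L[ℂ] Y)) : Prop :=
  ∃ ε > (0 : ℝ), ∀ z : ℂ, ‖z‖ < ε →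
    IsUnit ((1 : X →L[ℂ] X) - z • A) ∧ transferAt A B C D z = θ z

/-- the system realizes the (pointwise) inverse of `Bf` near the origin. -/
def IsRealizationOfInv (A : X →L[ℂ] X) (B : U →L[ℂ] X) (C : X →L[ℂ] U) (D : U →L[ℂ] U)
    (Bf : ℂ → (U →L[ℂ] U)) : Prop :=
  ∃ ε > (0 : ℝ), ∀ z : ℂ, ‖z‖ < ε →
    IsUnit ((1 : X →L[ℂ] X) - z • A) ∧
      transferAt A B C D z ∘L Bf z = 1 ∧ Bf z ∘L transferAt A B C D z = 1

end Ops

section Schur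

variable [NormedAddCommGroup U] [InnerProductSpace ℂ U] [CompleteSpace U]
  [NormedAddCommGroup Y] [InnerProductSpace ℂ Y] [CompleteSpace Y]

/-- the Schur kernel `K_S(w,z) = (I - S(z)S(w)*)/(1 - z conj w)`. -/
def schurKernel (S : ℂ → (U →L[ℂ] Y)) (w z : ℂ) : Y →L[ℂ] Y :=
  ((1 : ℂ) - z * (starRingEnd ℂ w))⁻¹ •
    ((1 : Y →L[ℂ] Y) - (S z) ∘L ContinuousLinearMap.adjoint (S w))

/-- the quadratic form `c ↦ ∑ conj (c i) * c j * ⟨K(w j, w i) (f j), f i⟩` is negative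
definite on the subspace `V`. -/
def KernelNegOn (S : ℂ → (U →L[ℂ] Y)) {n : ℕ} (w : Fin n → ℂ) (f : Fin n → Y)
    (V : Submodule ℂ (Fin n → ℂ)) : Prop :=
  ∀ c ∈ V, c ≠ 0 →
    (∑ i, ∑ j, (starRingEnd ℂ (c i)) * c j * ⟪schurKernel S (w j) (w i) (f j), f i⟫).re < 0

/-- membership of the generalized Schur class `S_κ(U,Y)` for a function holomorphic on `Ω`. -/
structure MemGenSchur (S : ℂ → (U →L[ℂ] Y)) (Ω : Set ℂ) (κ : ℕ) : Prop where
  isOpen : IsOpen Ω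
  zero_mem : (0 : ℂ) ∈ Ω
  subset : Ω ⊆ ball (0 : ℂ) 1
  holo : DifferentiableOn ℂ S Ω
  negSq_le : ∀ (n : ℕ) (w : Fin n → ℂ), (∀ i, w i ∈ Ω) → ∀ (f : Fin n → Y)
      (V : Submodule ℂ (Fin n → ℂ)), KernelNegOn S w f V → Module.finrank ℂ V ≤ κ
  negSq_attained : ∃ (n : ℕ) (w : Fin n → ℂ), (∀ i, w i ∈ Ω) ∧ ∃ (f : Fin n → Y)
      (V : Submodule ℂ (Fin n → ℂ)), KernelNegOn S w f V ∧ Module.finrank ℂ V = κ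

/-- the classical Schur class `S(U,Y) = S₀(U,Y)`. -/
def MemSchurClassZero (S : ℂ → (U →L[ℂ] Y)) : Prop :=
  DifferentiableOn ℂ S (ball (0 : ℂ) 1) ∧ ∀ z ∈ ball (0 : ℂ) 1, ‖S z‖ ≤ 1

/-- a simple Blaschke–Potapov factor. -/
def blaschkeFactor (P : U →L[ℂ] U) (ρ α z : ℂ) : U →L[ℂ] U :=
  ((1 : U →L[ℂ] U) - P) + (ρ * ((z - α) / (1 - (starRingEnd ℂ α) * z))) • P

/-- a Blaschke product of degree `κ`. -/
def IsBlaschkeProd (κ : ℕ) (Bf : ℂ → (U →L[ℂ] U)) : Prop :=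
  ∃ (P : Fin κ → (U →L[ℂ] U)) (ρ α : Fin κ → ℂ),
    (∀ k, IsSelfAdjoint (P k) ∧ P k ∘L P k = P k ∧
        Module.finrank ℂ (LinearMap.range ((P k : U →ₗ[ℂ] U))) = 1) ∧
    (∀ k, ‖ρ k‖ = 1) ∧ (∀ k, 0 < ‖α k‖ ∧ ‖α k‖ < 1) ∧
    ∀ z, Bf z = (List.ofFn (fun k => blaschkeFactor (P k) (ρ k) (α k) z)).prod

end Schur

section KL

variable [NormedAddCommGroup U] [InnerProductSpace ℂ U] [CompleteSpace U]
  [NormedAddCommGroup Y] [InnerProductSpace ℂ Y] [CompleteSpace Y]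

/-- a right Kreĭn–Langer factorization `θ = θr · Br⁻¹` on `Ω`. -/
def IsRightKLFact (θ θr : ℂ → (U →L[ℂ] Y)) (Br : ℂ → (U →L[ℂ] U)) (Ω : Set ℂ)
    (κ : ℕ) : Prop :=
  MemSchurClassZero θr ∧ IsBlaschkeProd κ Br ∧ (∀ z ∈ Ω, θ z ∘L Br z = θr z) ∧
    ∀ w ∈ ball (0 : ℂ) 1, ∀ f : U, Br w f = 0 → θr w f = 0 → f = 0

/-- a left Kreĭn–Langer factorization `θ = Bl⁻¹ · θl` on `Ω`. -/
def IsLeftKLFact (θ θl : ℂ → (U →L[ℂ] Y)) (Bl : ℂ → (Y →L[ℂ] Y)) (Ω : Set ℂ)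
    (κ : ℕ) : Prop :=
  MemSchurClassZero θl ∧ IsBlaschkeProd κ Bl ∧ (∀ z ∈ Ω, Bl z ∘L θ z = θl z) ∧
    ∀ w ∈ ball (0 : ℂ) 1, ∀ g : Y,
      ContinuousLinearMap.adjoint (Bl w) g = 0 →
      ContinuousLinearMap.adjoint (θl w) g = 0 → g = 0

end KL

section Prod2

variable (X₁ X₂ : Type*) [NormedAddCommGroup X₁] [InnerProductSpace ℂ X₁] [CompleteSpace X₁]
  [NormedAddCommGroup X₂] [InnerProductSpace ℂ X₂] [CompleteSpace X₂]

/-- the state space `X₁ ⊕ X₂` of a product of systems. -/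
abbrev ProdState := WithLp 2 (X₁ × X₂)

variable {X₁ X₂}
  {U Y₁ Y : Type*} [NormedAddCommGroup U] [InnerProductSpace ℂ U] [CompleteSpace U]
  [NormedAddCommGroup Y₁] [InnerProductSpace ℂ Y₁] [CompleteSpace Y₁]
  [NormedAddCommGroup Y] [InnerProductSpace ℂ Y] [CompleteSpace Y]

/-- identification of `ProdState X₁ X₂` with `X₁ × X₂`. -/
def eP : ProdState X₁ X₂ ≃L[ℂ] X₁ × X₂ := WithLp.prodContinuousLinearEquiv 2 ℂ X₁ X₂

/-- the fundamental symmetry `J₁ ⊕ J₂` on the product state space. -/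
def prodJ (J₁ : X₁ →L[ℂ] X₁) (J₂ : X₂ →L[ℂ] X₂) :
    ProdState X₁ X₂ →L[ℂ] ProdState X₁ X₂ :=
  eP.symm.toContinuousLinearMap ∘L
    ((J₁ ∘L fst ℂ X₁ X₂).prod (J₂ ∘L snd ℂ X₁ X₂)) ∘L eP.toContinuousLinearMap

/-- main operator `[[A₁, 0], [B₂C₁, A₂]]` of the product system `Σ₂ ∘ Σ₁`. -/
def prodA (A₁ : X₁ →L[ℂ] X₁) (C₁ : X₁ →L[ℂ] Y₁) (A₂ : X₂ →L[ℂ] X₂) (B₂ : Y₁ →L[ℂ] X₂) :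
    ProdState X₁ X₂ →L[ℂ] ProdState X₁ X₂ :=
  eP.symm.toContinuousLinearMap ∘L
    ((A₁ ∘L fst ℂ X₁ X₂).prod ((B₂ ∘L C₁ ∘L fst ℂ X₁ X₂) + (A₂ ∘L snd ℂ X₁ X₂))) ∘L
      eP.toContinuousLinearMap

/-- control operator `[B₁; B₂D₁]` of the product system `Σ₂ ∘ Σ₁`. -/
def prodB (B₁ : U →L[ℂ] X₁) (D₁ : U →L[ℂ] Y₁) (B₂ : Y₁ →L[ℂ] X₂) :
    U →L[ℂ] ProdState X₁ X₂ :=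
  eP.symm.toContinuousLinearMap ∘L (B₁.prod (B₂ ∘L D₁))

/-- observation operator `[D₂C₁, C₂]` of the product system `Σ₂ ∘ Σ₁`. -/
def prodC (C₁ : X₁ →L[ℂ] Y₁) (C₂ : X₂ →L[ℂ] Y) (D₂ : Y₁ →L[ℂ] Y) :
    ProdState X₁ X₂ →L[ℂ] Y :=
  ((D₂ ∘L C₁).coprod C₂) ∘L eP.toContinuousLinearMap

/-- feedthrough operator `D₂D₁` of the product system `Σ₂ ∘ Σ₁`. -/
def prodD (D₁ : U →L[ℂ] Y₁) (D₂ : Y₁ →L[ℂ] Y) : U →L[ℂ] Y := D₂ ∘L D₁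

end Prod2

section Boundary

variable [NormedAddCommGroup U] [InnerProductSpace ℂ U] [CompleteSpace U]
  [NormedAddCommGroup Y] [InnerProductSpace ℂ Y] [CompleteSpace Y]

/-- `T` is the strong radial limit of `θ` at the boundary point `exp(i t)`. -/
def RadialLimitAt (θ : ℂ → (U →L[ℂ] Y)) (t : ℝ) (T : U →L[ℂ] Y) : Prop :=
  ∀ u : U, Tendsto (fun r : ℝ => θ ((r : ℂ) * Complex.exp (Complex.I * t)) u)
    (𝓝[<] (1 : ℝ)) (𝓝 (T u))

/-- the strong radial boundary values of `θ` exist a.e. and are contractions. -/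
def HasContractiveBoundaryValues (θ : ℂ → (U →L[ℂ] Y)) : Prop :=
  ∀ᵐ t ∂(volume : Measure ℝ), ∃ T : U →L[ℂ] Y, RadialLimitAt θ t T ∧ ‖T‖ ≤ 1

/-- `θ` has isometric boundary values a.e. -/
def HasIsometricBoundaryValues (θ : ℂ → (U →L[ℂ] Y)) : Prop :=
  ∀ᵐ t ∂(volume : Measure ℝ), ∃ T : U →L[ℂ] Y, RadialLimitAt θ t T ∧
    ContinuousLinearMap.adjoint T ∘L T = 1

/-- `θ` has co-isometric boundary values a.e. -/
def HasCoisometricBoundaryValues (θ : ℂ → (U →L[ℂ] Y)) : Prop :=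
  ∀ᵐ t ∂(volume : Measure ℝ), ∃ T : U →L[ℂ] Y, RadialLimitAt θ t T ∧
    T ∘L ContinuousLinearMap.adjoint T = 1

/-- `θ` has unitary boundary values a.e. -/
def HasUnitaryBoundaryValues (θ : ℂ → (U →L[ℂ] Y)) : Prop :=
  ∀ᵐ t ∂(volume : Measure ℝ), ∃ T : U →L[ℂ] Y, RadialLimitAt θ t T ∧
    ContinuousLinearMap.adjoint T ∘L T = 1 ∧ T ∘L ContinuousLinearMap.adjoint T = 1

/-- the right defect function of `θ` vanishes identically: the only Schur-class function
`φ` with `φ(ζ)*φ(ζ) ≤ I − θ(ζ)*θ(ζ)` a.e. on the circle is `φ ≡ 0`. -/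
def RightDefectZero (θ : ℂ → (U →L[ℂ] Y)) : Prop :=
  ∀ (K : Type) (_ : NormedAddCommGroup K) (_ : InnerProductSpace ℂ K) (_ : CompleteSpace K)
    (φ : ℂ → (U →L[ℂ] K)), MemSchurClassZero φ →
    (∀ᵐ t ∂(volume : Measure ℝ), ∃ (T : U →L[ℂ] Y) (F : U →L[ℂ] K),
      RadialLimitAt θ t T ∧ RadialLimitAt φ t F ∧
        ∀ u : U, ‖F u‖ ^ 2 ≤ ‖u‖ ^ 2 - ‖T u‖ ^ 2) →
    ∀ z ∈ ball (0 : ℂ) 1, φ z = 0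

/-- the left defect function of `θ` vanishes identically: the only Schur-class function
`ψ` with `ψ(ζ)ψ(ζ)* ≤ I − θ(ζ)θ(ζ)*` a.e. on the circle is `ψ ≡ 0`. -/
def LeftDefectZero (θ : ℂ → (U →L[ℂ] Y)) : Prop :=
  ∀ (K : Type) (_ : NormedAddCommGroup K) (_ : InnerProductSpace ℂ K) (_ : CompleteSpace K)
    (ψ : ℂ → (K →L[ℂ] Y)), MemSchurClassZero ψ →
    (∀ᵐ t ∂(volume : Measure ℝ), ∃ (T : U →L[ℂ] Y) (P : K →L[ℂ] Y),
      RadialLimitAt θ t T ∧ RadialLimitAt ψ t P ∧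
        ∀ y : Y, ‖ContinuousLinearMap.adjoint P y‖ ^ 2
          ≤ ‖y‖ ^ 2 - ‖ContinuousLinearMap.adjoint T y‖ ^ 2) →
    ∀ z ∈ ball (0 : ℂ) 1, ψ z = 0

end Boundary

section RKPS

variable {U Y : Type*} [NormedAddCommGroup U] [InnerProductSpace ℂ U] [CompleteSpace U]
  [NormedAddCommGroup Y] [InnerProductSpace ℂ Y] [CompleteSpace Y]
  {H : Type*} [NormedAddCommGroup H] [InnerProductSpace ℂ H] [CompleteSpace H]

/-- `(H, JH, ev)` is a model of the reproducing kernel Pontryagin space `H(S)` of the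
Schur kernel of `S` on `Ω`: `H` is a Pontryagin space of negative index `κ` whose elements
are (via `ev`) `Y`-valued functions on `Ω`, containing the kernel functions and having the
reproducing property `[h, K_S(w,·)f] = ⟨h(w), f⟩`. -/
structure IsRKPS (S : ℂ → (U →L[ℂ] Y)) (Ω : Set ℂ) (κ : ℕ)
    (JH : H →L[ℂ] H) (ev : H →ₗ[ℂ] (ℂ → Y)) : Prop where
  fund : IsFundamentalSymmetry JH κ
  repro : ∀ w ∈ Ω, ∀ f : Y, ∃ k : H, (∀ z ∈ Ω, ev k z = schurKernel S w z f) ∧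
      ∀ h : H, ⟪JH h, k⟫ = ⟪ev h w, f⟫
  sep : ∀ h : H, (∀ z ∈ Ω, ev h z = 0) → h = 0

/-- `S^#(z) := (S(conj z))*`. -/
def sharp (S : ℂ → (U →L[ℂ] Y)) : ℂ → (Y →L[ℂ] U) :=
  fun z => ContinuousLinearMap.adjoint (S (starRingEnd ℂ z))

end RKPS


/-- Observability: a vector annihilated by all `C Aⁿ` is zero. -/
theorem eq_zero_of_obs
    {X Y : Type*} [NormedAddCommGroup X] [InnerProductSpace ℂ X] [CompleteSpace X]
    [NormedAddCommGroup Y] [InnerProductSpace ℂ Y] [CompleteSpace Y]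
    (J A : X →L[ℂ] X) (C : X →L[ℂ] Y) (hs : IsSelfAdjoint J)
    (hJ : J ∘L J = ContinuousLinearMap.id ℂ X) (ho : obsSpace J A C = ⊤)
    (g : X) (hg : ∀ n : ℕ, C ((A ^ n) g) = 0) : g = 0 := by
  have hJJ : ∀ x, J (J x) = x := fun x => by
    simpa using congrArg (fun T : X →L[ℂ] X => T x) hJ
  have hJa : ∀ x y : X, ⟪J x, y⟫ = ⟪x, J y⟫ := fun x y => by
    rw [← ContinuousLinearMap.adjoint_inner_right, hs.adjoint_eq]
  have key : ∀ (n : ℕ) (x w : X),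
      ⟪((iadj J J A) ^ n) x, J w⟫ = ⟪x, J ((A ^ n) w)⟫ := by
    intro n
    induction n with
    | zero => intro x w; simp
    | succ k ih =>
      intro x w
      rw [pow_succ, pow_succ]
      simp only [mul_apply_eq_comp]
      have h1 : (A ^ k) (A w) = A ((A ^ k) w) := by
        rw [← mul_apply_eq_comp, ← mul_apply_eq_comp,
          ← pow_succ, ← pow_succ']
      rw [ih, h1]
      simp only [iadj, ContinuousLinearMap.comp_apply]
      rw [hJa, hJJ, ContinuousLinearMap.adjoint_inner_left, hJa]
  set V : Submodule ℂ X := ⨆ n : ℕ, LinearMap.range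
    ((((iadj J J A) ^ n) ∘L (J ∘L ContinuousLinearMap.adjoint C)) : Y →ₗ[ℂ] X) with hV
  have hle : V ≤ (ℂ ∙ (J g))ᗮ := by
    refine iSup_le fun n => ?_
    rintro _ ⟨y, rfl⟩
    rw [Submodule.mem_orthogonal_singleton_iff_inner_left]
    simp only [ContinuousLinearMap.coe_coe, ContinuousLinearMap.comp_apply]
    rw [key, hJa, hJJ, ContinuousLinearMap.adjoint_inner_left, hg, inner_zero_right]
  have htop : (⊤ : Submodule ℂ X) ≤ (ℂ ∙ (J g))ᗮ := by
    rw [← ho]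
    exact Submodule.topologicalClosure_minimal _ hle (Submodule.isClosed_orthogonal _)
  have h0 : ⟪J g, J g⟫ = 0 :=
    (Submodule.mem_orthogonal_singleton_iff_inner_left).1 (htop (Submodule.mem_top (x := J g)))
  have h1 : J g = 0 := inner_self_eq_zero.1 h0
  rw [← hJJ g, h1, map_zero]

/-- Controllability: a submodule containing all `Aⁿ B u` is dense. -/
theorem dense_of_ctrl
    {X U : Type*} [NormedAddCommGroup X] [InnerProductSpace ℂ X] [CompleteSpace X]
    [NormedAddCommGroup U] [InnerProductSpace ℂ U] [CompleteSpace U]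
    (A : X →L[ℂ] X) (B : U →L[ℂ] X) (hc : ctrlSpace A B = ⊤) (M : Submodule ℂ X)
    (hM : ∀ (n : ℕ) (u : U), (A ^ n) (B u) ∈ M) : Dense (M : Set X) := by
  rw [Submodule.dense_iff_topologicalClosure_eq_top, eq_top_iff, ← hc]
  refine Submodule.topologicalClosure_mono (iSup_le fun n => ?_)
  rintro _ ⟨u, rfl⟩
  exact hM n u

/-- two minimal passive realizations (with Pontryagin state spaces of the same
negative index `κ`) of the same transfer function are weakly similar. -/
theorem minimal_passive_realizations_weakly_similar
    {X₁ X₂ U Y : Type*} [NormedAddCommGroup X₁] [InnerProductSpace ℂ X₁] [CompleteSpace X₁] [NormedAddCommGroup X₂] [InnerProductSpace ℂ X₂] [CompleteSpace X₂] [NormedAddCommGroup U] [InnerProductSpace ℂ U] [CompleteSpace U] [NormedAddCommGroup Y] [InnerProductSpace ℂ Y] [CompleteSpace Y]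
    (κ : ℕ) (J₁ : X₁ →L[ℂ] X₁) (J₂ : X₂ →L[ℂ] X₂)
    (hJ₁ : IsFundamentalSymmetry J₁ κ) (hJ₂ : IsFundamentalSymmetry J₂ κ)
    (A₁ : X₁ →L[ℂ] X₁) (B₁ : U →L[ℂ] X₁) (C₁ : X₁ →L[ℂ] Y) (D₁ : U →L[ℂ] Y)
    (A₂ : X₂ →L[ℂ] X₂) (B₂ : U →L[ℂ] X₂) (C₂ : X₂ →L[ℂ] Y) (D₂ : U →L[ℂ] Y)
    (hp₁ : IsPassive J₁ A₁ B₁ C₁ D₁) (hp₂ : IsPassive J₂ A₂ B₂ C₂ D₂)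
    (hc₁ : ctrlSpace A₁ B₁ = ⊤) (ho₁ : obsSpace J₁ A₁ C₁ = ⊤)
    (hc₂ : ctrlSpace A₂ B₂ = ⊤) (ho₂ : obsSpace J₂ A₂ C₂ = ⊤)
    (hD : D₁ = D₂)
    (hmom : ∀ n : ℕ, C₁ ∘L (A₁ ^ n) ∘L B₁ = C₂ ∘L (A₂ ^ n) ∘L B₂) :
    ∃ Z : X₁ →ₗ.[ℂ] X₂,
      IsClosed (Z.graph : Set (X₁ × X₂)) ∧
      Dense (Z.domain : Set X₁) ∧
      (∀ f : Z.domain, Z f = 0 → (f : X₁) = 0) ∧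
      Dense (Set.range fun f : Z.domain => Z f) ∧
      (∀ (f : X₁) (hf : f ∈ Z.domain), ∃ hf' : A₁ f ∈ Z.domain,
        Z ⟨A₁ f, hf'⟩ = A₂ (Z ⟨f, hf⟩) ∧ C₁ f = C₂ (Z ⟨f, hf⟩)) ∧
      (∀ u : U, ∃ hu : B₁ u ∈ Z.domain, Z ⟨B₁ u, hu⟩ = B₂ u) := by
  let G : Submodule ℂ (X₁ × X₂) := ⨅ n : ℕ, LinearMap.ker
    (((C₁ ∘L (A₁ ^ n)) ∘L ContinuousLinearMap.fst ℂ X₁ X₂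
      - (C₂ ∘L (A₂ ^ n)) ∘L ContinuousLinearMap.snd ℂ X₁ X₂ : (X₁ × X₂) →L[ℂ] Y) :
        (X₁ × X₂) →ₗ[ℂ] Y)
  have hG : ∀ p : X₁ × X₂, p ∈ G ↔ ∀ n : ℕ, C₁ ((A₁ ^ n) p.1) = C₂ ((A₂ ^ n) p.2) := by
    intro p
    simp only [G, Submodule.mem_iInf]
    refine forall_congr' fun n => ?_
    exact sub_eq_zero
  have hsing : ∀ p ∈ G, p.1 = 0 → p.2 = 0 := by
    intro p hp h
    refine eq_zero_of_obs J₂ A₂ C₂ hJ₂.1 hJ₂.2.1 ho₂ _ fun n => ?_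
    rw [← (hG p).1 hp n, h, map_zero, map_zero]
  have hgr : G.toLinearPMap.graph = G :=
    Submodule.toLinearPMap_graph_eq G (fun p hp h => hsing p hp h)
  have hval : ∀ f g, (f, g) ∈ G → ∃ hf : f ∈ G.toLinearPMap.domain,
      G.toLinearPMap ⟨f, hf⟩ = g := by
    intro f g h
    rw [← hgr, LinearPMap.mem_graph_iff] at h
    obtain ⟨y, rfl, hy⟩ := h
    exact ⟨y.2, hy⟩
  have hmem : ∀ f (hf : f ∈ G.toLinearPMap.domain), (f, G.toLinearPMap ⟨f, hf⟩) ∈ G := by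
    intro f hf
    have := G.toLinearPMap.mem_graph ⟨f, hf⟩
    rwa [hgr] at this
  have hstep : ∀ f g, (f, g) ∈ G → (A₁ f, A₂ g) ∈ G := by
    intro f g h
    rw [hG] at h ⊢
    intro n
    have := h (n + 1)
    simpa [pow_succ] using this
  have hB : ∀ u, (B₁ u, B₂ u) ∈ G := by
    intro u
    rw [hG]
    intro n
    simpa using congrArg (fun T : U →L[ℂ] Y => T u) (hmom n)
  have hAB : ∀ (n : ℕ) (u : U), ((A₁ ^ n) (B₁ u), (A₂ ^ n) (B₂ u)) ∈ G := by
    intro n u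
    induction n with
    | zero => simpa using hB u
    | succ k ih =>
      have := hstep _ _ ih
      simpa [pow_succ'] using this
  refine ⟨G.toLinearPMap, ?_, ?_, ?_, ?_, ?_, ?_⟩
  · rw [hgr]
    have : (G : Set (X₁ × X₂)) = ⋂ n : ℕ,
        {p : X₁ × X₂ | C₁ ((A₁ ^ n) p.1) = C₂ ((A₂ ^ n) p.2)} := by
      ext p
      simp only [SetLike.mem_coe, hG, Set.mem_iInter, Set.mem_ofPred_eq]
    rw [this]
    exact isClosed_iInter fun n => isClosed_eq (by fun_prop) (by fun_prop)
  · exact dense_of_ctrl A₁ B₁ hc₁ _ fun n u => (hval _ _ (hAB n u)).1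
  · rintro ⟨f, hf⟩ h
    have h1 := (hG _).1 (hmem f hf)
    refine eq_zero_of_obs J₁ A₁ C₁ hJ₁.1 hJ₁.2.1 ho₁ _ fun n => ?_
    have h2 := h1 n
    rw [h] at h2
    simpa using h2
  · have := dense_of_ctrl A₂ B₂ hc₂ (LinearMap.range G.toLinearPMap.toFun) fun n u => by
      obtain ⟨hf, h⟩ := hval _ _ (hAB n u)
      exact ⟨⟨_, hf⟩, h⟩
    exact this
  · intro f hf
    obtain ⟨hf', h⟩ := hval _ _ (hstep _ _ (hmem f hf))
    refine ⟨hf', h, ?_⟩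
    simpa using (hG _).1 (hmem f hf) 0
  · intro u
    exact hval _ _ (hB u)


end Pontryagin
end
end

section
/- Let U, Y₁, Y be Hilbert spaces, S₁ ∈ S_{κ₁}(U,Y₁), S₂ ∈ S_{κ₂}(Y₁,Y), and let Σ₁ = (A₁,B₁,C₁,D₁;X₁,U,Y₁;κ₁) and Σ₂ = (A₂,B₂,C₂,D₂;X₂,Y₁,Y;κ₂) be co-isometric observable realizations of S₁ and S₂, respectively. Set S = S₂S₁. Then Σ₂∘Σ₁ is a co-isometric observable realization of S if and only if the following two conditions hold: (i) H(S) = S₂·H(S₁) ⊕ H(S₂), i.e. every h ∈ H(S) can be written uniquely as h = S₂h₁ + h₂ with h₁ ∈ H(S₁) and h₂ ∈ H(S₂), the inclusion of H(S₂) into H(S) is isometric ([h₂,h₂']_{H(S)} = [h₂,h₂']_{H(S₂)}), and [S₂h₁, h₂]_{H(S)} = 0 for all h₁ ∈ H(S₁), h₂ ∈ H(S₂); and (ii) the map h₁ ↦ S₂h₁ is an isometry of H(S₁) into H(S), i.e. [S₂h₁, S₂h₁']_{H(S)} = [h₁,h₁']_{H(S₁)} for all h₁, h₁' ∈ H(S₁).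 -/
open MeasureTheory ContinuousLinearMap Filter Topology Metric
open scoped ComplexConjugate

noncomputable section

namespace Pontryagin

variable {X X' U Y : Type*}

/-! ### Pontryagin space geometry -/

set_option linter.unusedSectionVars false

section Geometry

variable {X X' : Type*} [NormedAddCommGroup X] [InnerProductSpace ℂ X] [CompleteSpace X]
  [NormedAddCommGroup X'] [InnerProductSpace ℂ X'] [CompleteSpace X']

/-- the eigenspace for `-1`. -/
abbrev negK (J : X →L[ℂ] X) : Submodule ℂ X := LinearMap.ker ((J : X →ₗ[ℂ] X) + LinearMap.id)

/-- a symmetry whose negative eigenspace is honestly finite dimensional. -/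
structure Pont (J : X →L[ℂ] X) : Prop where
  sa : ∀ x y, ⟪J x, y⟫ = ⟪x, J y⟫
  inv : ∀ x, J (J x) = x
  fin : FiniteDimensional ℂ (negK J)

theorem Pont.norm {J : X →L[ℂ] X} (h : Pont J) (x : X) : ‖J x‖ = ‖x‖ := by
  have h1 : ⟪J x, J x⟫ = ⟪x, x⟫ := by rw [h.sa, h.inv]
  rw [inner_self_eq_norm_sq_to_K, inner_self_eq_norm_sq_to_K] at h1
  have h2 : ‖J x‖ ^ 2 = ‖x‖ ^ 2 := by exact_mod_cast h1
  exact (pow_left_inj₀ (norm_nonneg _) (norm_nonneg _) two_ne_zero).1 h2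

theorem Pont.form_le {J : X →L[ℂ] X} (h : Pont J) (x y : X) : ‖⟪J x, y⟫‖ ≤ ‖x‖ * ‖y‖ := by
  rw [← h.norm x]; exact norm_inner_le_norm _ _

theorem Pont.form_symm {J : X →L[ℂ] X} (h : Pont J) (x y : X) :
    ⟪J x, y⟫ = conj ⟪J y, x⟫ := by
  rw [inner_conj_symm, h.sa]

theorem Pont.form_re_symm {J : X →L[ℂ] X} (h : Pont J) (x y : X) :
    (⟪J x, y⟫).re = (⟪J y, x⟫).re := by
  rw [h.form_symm x y, Complex.conj_re]

theorem Pont.form_add {J : X →L[ℂ] X} (h : Pont J) (x y : X) :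
    (⟪J (x + y), x + y⟫).re = (⟪J x, x⟫).re + 2 * (⟪J x, y⟫).re + (⟪J y, y⟫).re := by
  have := h.form_re_symm x y
  simp only [map_add, inner_add_left, inner_add_right, Complex.add_re]
  linarith

theorem Pont.form_sub {J : X →L[ℂ] X} (h : Pont J) (x y : X) :
    (⟪J (x - y), x - y⟫).re = (⟪J x, x⟫).re - 2 * (⟪J x, y⟫).re + (⟪J y, y⟫).re := by
  have := h.form_re_symm x y
  simp only [map_sub, inner_sub_left, inner_sub_right, Complex.sub_re]
  linarith

theorem Pont.negproj_mem {J : X →L[ℂ] X} (h : Pont J) (x : X) : x - J x ∈ negK J := by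
  simp [LinearMap.mem_ker, h.inv]

/-- twice the projection onto the negative eigenspace. -/
def Pont.negproj {J : X →L[ℂ] X} (h : Pont J) : X →ₗ[ℂ] negK J where
  toFun x := ⟨x - J x, h.negproj_mem x⟩
  map_add' x y := by ext; simp; abel
  map_smul' c x := by ext; simp [smul_sub]

theorem Pont.form_of_negproj {J : X →L[ℂ] X} (h : Pont J) {x : X} (hx : h.negproj x = 0) :
    (⟪J x, x⟫).re = ‖x‖ ^ 2 := by
  have h1 : x - J x = 0 := congrArg Subtype.val hx
  rw [← sub_eq_zero.1 h1]
  rw [inner_self_eq_norm_sq_to_K]; norm_cast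

/-- a subspace on which `[v,v] < ‖v‖²` has dimension at most the index. -/
theorem Pont.card_le {J : X →L[ℂ] X} (h : Pont J) {E : Type*} [AddCommGroup E] [Module ℂ E]
    (s : E →ₗ[ℂ] X) (hs : ∀ c, c ≠ 0 → (⟪J (s c), s c⟫).re < ‖s c‖ ^ 2) :
    Function.Injective (h.negproj ∘ₗ s) := by
  rw [← LinearMap.ker_eq_bot, LinearMap.ker_eq_bot']
  intro c hc
  by_contra hne
  exact (hs c hne).ne (h.form_of_negproj hc)

theorem Pont.finrank_le {J : X →L[ℂ] X} (h : Pont J) {n : ℕ}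
    (s : EuclideanSpace ℂ (Fin n) →ₗ[ℂ] X)
    (hs : ∀ c, c ≠ 0 → (⟪J (s c), s c⟫).re < ‖s c‖ ^ 2) :
    n ≤ Module.finrank ℂ (negK J) := by
  have := h.fin
  have := LinearMap.finrank_le_finrank_of_injective (h.card_le s hs)
  simpa using this

theorem Pont.neg_bound {J : X →L[ℂ] X} (h : Pont J) {n : ℕ}
    (hn : Module.finrank ℂ (negK J) ≤ n)
    (s : EuclideanSpace ℂ (Fin n) →ₗ[ℂ] X) {δ : ℝ} (hδ : 0 < δ)
    (hs : ∀ c, (⟪J (s c), s c⟫).re ≤ -δ * ‖c‖ ^ 2) :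
    ∃ C > 0, ∀ (g : X) (b : ℝ), 0 ≤ b → (∀ c, ‖⟪J g, s c⟫‖ ≤ b * ‖c‖) →
      ‖g‖ ^ 2 ≤ C * ((⟪J g, g⟫).re + 2 / δ * b ^ 2) := by
  have := h.fin
  have hs' : ∀ c, c ≠ 0 → (⟪J (s c), s c⟫).re < ‖s c‖ ^ 2 := by
    intro c hc
    have : 0 < ‖c‖ := norm_pos_iff.2 hc
    have h2 : 0 < δ * ‖c‖ ^ 2 := by positivity
    have := hs c
    have : 0 ≤ ‖s c‖ ^ 2 := by positivity
    linarith
  have hinj := h.card_le s hs'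
  have hle := h.finrank_le s hs'
  have hsurj : Function.Surjective (h.negproj ∘ₗ s) :=
    (LinearMap.injective_iff_surjective_of_finrank_eq_finrank (by
      simp; omega)).1 hinj
  set Λ := ‖LinearMap.toContinuousLinearMap s‖ with hΛ
  have hΛs : ∀ c, ‖s c‖ ≤ Λ * ‖c‖ := fun c =>
    (LinearMap.toContinuousLinearMap s).le_opNorm c
  refine ⟨2 + 4 * Λ ^ 2 / δ, by positivity, fun g b hb hgb => ?_⟩
  obtain ⟨c, hc⟩ := hsurj (h.negproj g)
  have hr : (⟪J (g - s c), g - s c⟫).re = ‖g - s c‖ ^ 2 := by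
    apply h.form_of_negproj
    rw [map_sub, sub_eq_zero]; exact hc.symm
  rw [h.form_sub] at hr
  have h1 : -(⟪J g, s c⟫).re ≤ b * ‖c‖ :=
    (neg_le_abs _).trans ((Complex.abs_re_le_norm _).trans (hgb c))
  have h2 := hs c
  have h3 : 2 * b * ‖c‖ ≤ δ / 2 * ‖c‖ ^ 2 + 2 / δ * b ^ 2 := by
    have : 0 ≤ (δ / 2) * (‖c‖ - 2 / δ * b) ^ 2 := by positivity
    have e : (δ / 2) * (‖c‖ - 2 / δ * b) ^ 2
        = δ / 2 * ‖c‖ ^ 2 + 2 / δ * b ^ 2 - 2 * b * ‖c‖ := by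
      field_simp; ring
    linarith
  set Q := (⟪J g, g⟫).re + 2 / δ * b ^ 2 with hQ
  have h4 : ‖g - s c‖ ^ 2 + δ / 2 * ‖c‖ ^ 2 ≤ Q := by rw [hQ]; linarith
  have h5 : ‖g‖ ≤ ‖g - s c‖ + Λ * ‖c‖ := by
    calc ‖g‖ = ‖(g - s c) + s c‖ := by simp
      _ ≤ _ := (norm_add_le _ _).trans (by gcongr; exact hΛs c)
  have h6 : ‖g‖ ^ 2 ≤ 2 * ‖g - s c‖ ^ 2 + 2 * (Λ ^ 2 * ‖c‖ ^ 2) := by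
    have : ‖g‖ ^ 2 ≤ (‖g - s c‖ + Λ * ‖c‖) ^ 2 := by gcongr
    nlinarith [sq_nonneg (‖g - s c‖ - Λ * ‖c‖)]
  have h7 : ‖g - s c‖ ^ 2 ≤ Q := by
    have : 0 ≤ δ / 2 * ‖c‖ ^ 2 := by positivity
    linarith
  have h8 : ‖c‖ ^ 2 ≤ 2 / δ * Q := by
    have : 0 ≤ ‖g - s c‖ ^ 2 := by positivity
    have h9 : δ / 2 * ‖c‖ ^ 2 ≤ Q := by linarith
    calc ‖c‖ ^ 2 = 2 / δ * (δ / 2 * ‖c‖ ^ 2) := by field_simp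
      _ ≤ _ := by gcongr
  calc ‖g‖ ^ 2 ≤ 2 * ‖g - s c‖ ^ 2 + 2 * (Λ ^ 2 * ‖c‖ ^ 2) := h6
    _ ≤ 2 * Q + 2 * (Λ ^ 2 * (2 / δ * Q)) := by gcongr
    _ = _ := by ring

theorem Pont.exists_neg {J : X →L[ℂ] X} (h : Pont J) {D : Submodule ℂ X}
    (hD : Dense (D : Set X)) :
    ∃ s : EuclideanSpace ℂ (Fin (Module.finrank ℂ (negK J))) →ₗ[ℂ] X,
      (∀ c, s c ∈ D) ∧ ∀ c, (⟪J (s c), s c⟫).re ≤ -(1 / 2) * ‖c‖ ^ 2 := by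
  have := h.fin
  set κ := Module.finrank ℂ (negK J) with hκ
  let e := (stdOrthonormalBasis ℂ (negK J)).repr.symm
  have hδ : (0 : ℝ) < 1 / (8 * (κ + 1)) := by positivity
  have hd : ∀ i, ∃ d ∈ (D : Set X), dist (e (EuclideanSpace.single i 1) : X) d < 1 / (8 * (κ + 1)) :=
    fun i => hD.exists_dist_lt _ hδ
  choose d hdD hd using hd
  let s : EuclideanSpace ℂ (Fin κ) →ₗ[ℂ] X :=
    { toFun := fun c => ∑ i, c i • d i
      map_add' := fun a b => by simp [add_smul, Finset.sum_add_distrib]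
      map_smul' := fun a b => by simp [mul_smul, Finset.smul_sum] }
  refine ⟨s, fun c => ?_, fun c => ?_⟩
  · change ∑ i, c i • d i ∈ D
    exact D.sum_mem fun i _ => D.smul_mem _ (hdD i)
  have hec : (e c : X) = ∑ i, c i • (e (EuclideanSpace.single i 1) : X) := by
    have : c = ∑ i, c i • (EuclideanSpace.single i (1:ℂ)) := by
      ext j; simp [Finset.sum_apply, Pi.single_apply]
    conv_lhs => rw [this]
    simp
  have hJe : J (e c : X) = -(e c : X) := by
    have := (e c).2
    rw [LinearMap.mem_ker] at this
    exact eq_neg_of_add_eq_zero_left this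
  have hn : ‖(e c : X)‖ = ‖c‖ := by
    exact e.norm_map c
  have hdiff : ‖s c - e c‖ ≤ ‖c‖ / 8 := by
    have : s c - e c = ∑ i, c i • (d i - (e (EuclideanSpace.single i 1) : X)) := by
      rw [hec]; simp [s, smul_sub]
    rw [this]
    calc _ ≤ ∑ i, ‖c i • (d i - (e (EuclideanSpace.single i 1) : X))‖ := norm_sum_le _ _
      _ ≤ ∑ i : Fin κ, ‖c‖ * (1 / (8 * (κ + 1))) := by
        apply Finset.sum_le_sum; intro i _
        rw [norm_smul]
        gcongr
        · exact PiLp.norm_apply_le c i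
        · rw [← dist_eq_norm, dist_comm]; exact (hd i).le
      _ = ‖c‖ / 8 * (κ / (κ + 1)) := by simp; field_simp
      _ ≤ ‖c‖ / 8 * 1 := by
        gcongr
        rw [div_le_one (by positivity)]; linarith
      _ = _ := by ring
  have hs : s c = e c + (s c - e c) := by abel
  rw [hs, h.form_add]
  have h1 : (⟪J (e c : X), (e c : X)⟫).re = -‖c‖ ^ 2 := by
    rw [hJe, inner_neg_left, inner_self_eq_norm_sq_to_K, hn]; norm_cast
  have h2 : (⟪J (e c : X), s c - e c⟫).re ≤ ‖c‖ * (‖c‖ / 8) := by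
    refine (Complex.re_le_norm _).trans ((h.form_le _ _).trans ?_)
    rw [hn]; gcongr
  have h3 : (⟪J (s c - e c), s c - e c⟫).re ≤ ‖c‖ / 8 * (‖c‖ / 8) := by
    refine (Complex.re_le_norm _).trans ((h.form_le _ _).trans ?_)
    gcongr
  rw [h1]
  nlinarith [sq_nonneg ‖c‖]

end Geometry

section Families

variable {X X' : Type*} [NormedAddCommGroup X] [InnerProductSpace ℂ X] [CompleteSpace X]
  [NormedAddCommGroup X'] [InnerProductSpace ℂ X'] [CompleteSpace X'] {ι : Type*}

theorem Pont.dense {J : X →L[ℂ] X} (h : Pont J) {k : ι → X}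
    (hk : ∀ x, (∀ a, ⟪J x, k a⟫ = 0) → x = 0) :
    Dense ((LinearMap.range (Finsupp.linearCombination ℂ k) : Submodule ℂ X) : Set X) := by
  rw [Finsupp.range_linearCombination, Submodule.dense_iff_topologicalClosure_eq_top,
    Submodule.topologicalClosure_eq_top_iff, Submodule.eq_bot_iff]
  intro x hx
  have h1 : J x = 0 := by
    apply hk
    intro a
    rw [h.inv]
    rw [Submodule.mem_orthogonal'] at hx
    exact hx _ (Submodule.subset_span ⟨a, rfl⟩)
  rw [← h.inv x, h1, map_zero]

theorem gram_lin {J : X →L[ℂ] X} {J' : X' →L[ℂ] X'} {k : ι → X} {k' : ι → X'}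
    (gram : ∀ a b, ⟪J (k a), k b⟫ = ⟪J' (k' a), k' b⟫) (c d : ι →₀ ℂ) :
    ⟪J (Finsupp.linearCombination ℂ k c), Finsupp.linearCombination ℂ k d⟫
      = ⟪J' (Finsupp.linearCombination ℂ k' c), Finsupp.linearCombination ℂ k' d⟫ := by
  simp only [Finsupp.linearCombination_apply, Finsupp.sum, map_sum, map_smul, sum_inner,
    inner_sum, inner_smul_left, inner_smul_right, gram]

theorem exists_neg_lift {J : X →L[ℂ] X} {J' : X' →L[ℂ] X'} (h : Pont J)
    {k : ι → X} {k' : ι → X'}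
    (hk : ∀ x, (∀ a, ⟪J x, k a⟫ = 0) → x = 0)
    (gram : ∀ a b, ⟪J (k a), k b⟫ = ⟪J' (k' a), k' b⟫) :
    ∃ t : EuclideanSpace ℂ (Fin (Module.finrank ℂ (negK J))) →ₗ[ℂ] (ι →₀ ℂ),
      ∀ c, (⟪J' (Finsupp.linearCombination ℂ k' (t c)),
        Finsupp.linearCombination ℂ k' (t c)⟫).re ≤ -(1 / 2) * ‖c‖ ^ 2 := by
  obtain ⟨s, hsD, hs⟩ := h.exists_neg (h.dense hk)
  obtain ⟨r, hr⟩ := LinearMap.exists_rightInverse_of_surjective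
    (Finsupp.linearCombination ℂ k).rangeRestrict (LinearMap.range_rangeRestrict _)
  refine ⟨r ∘ₗ s.codRestrict _ hsD, fun c => ?_⟩
  have e : Finsupp.linearCombination ℂ k ((r ∘ₗ s.codRestrict _ hsD) c) = s c := by
    have := LinearMap.congr_fun hr (s.codRestrict _ hsD c)
    exact congrArg Subtype.val this
  rw [← gram_lin gram, e]
  exact hs c

theorem index_le {J : X →L[ℂ] X} {J' : X' →L[ℂ] X'} (h : Pont J) (h' : Pont J')
    {k : ι → X} {k' : ι → X'}
    (hk : ∀ x, (∀ a, ⟪J x, k a⟫ = 0) → x = 0)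
    (gram : ∀ a b, ⟪J (k a), k b⟫ = ⟪J' (k' a), k' b⟫) :
    Module.finrank ℂ (negK J) ≤ Module.finrank ℂ (negK J') := by
  obtain ⟨t, ht⟩ := exists_neg_lift h hk gram
  refine h'.finrank_le (Finsupp.linearCombination ℂ k' ∘ₗ t) fun c hc => ?_
  have h1 := ht c
  have : 0 < ‖c‖ := norm_pos_iff.2 hc
  have h2 : 0 < ‖c‖ ^ 2 := by positivity
  have h3 : 0 ≤ ‖Finsupp.linearCombination ℂ k' (t c)‖ ^ 2 := by positivity
  simp only [LinearMap.comp_apply]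
  linarith

theorem exists_contr {J : X →L[ℂ] X} {J' : X' →L[ℂ] X'} (h : Pont J) (h' : Pont J')
    {k : ι → X} {k' : ι → X'}
    (hk : ∀ x, (∀ a, ⟪J x, k a⟫ = 0) → x = 0)
    (gram : ∀ a b, ⟪J (k a), k b⟫ = ⟪J' (k' a), k' b⟫)
    (hle : Module.finrank ℂ (negK J') ≤ Module.finrank ℂ (negK J)) :
    ∃ V : X' →L[ℂ] X, (∀ x a, ⟪J (V x), k a⟫ = ⟪J' x, k' a⟫) ∧
      ∀ x, (⟪J (V x), V x⟫).re ≤ (⟪J' x, x⟫).re := by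
  obtain ⟨t, ht⟩ := exists_neg_lift h hk gram
  set Φ := Finsupp.linearCombination ℂ k with hΦ
  set Φ' := Finsupp.linearCombination ℂ k' with hΦ'
  have hgr : ∀ c d, ⟪J (Φ c), Φ d⟫ = ⟪J' (Φ' c), Φ' d⟫ := gram_lin gram
  obtain ⟨C, hC, hb⟩ := h'.neg_bound hle (Φ' ∘ₗ t) (by norm_num : (0:ℝ) < 1 / 2) ht
  have hdense : DenseRange Φ := h.dense hk
  set Λ := ‖LinearMap.toContinuousLinearMap (Φ ∘ₗ t)‖ with hΛ
  have hΛs : ∀ c, ‖Φ (t c)‖ ≤ Λ * ‖c‖ := fun c =>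
    (LinearMap.toContinuousLinearMap (Φ ∘ₗ t)).le_opNorm c
  have hbd : ∃ C', ∀ d, ‖Φ' d‖ ≤ C' * ‖Φ d‖ := by
    refine ⟨Real.sqrt (C * (1 + 4 * Λ ^ 2)), fun d => ?_⟩
    have h1 := hb (Φ' d) (Λ * ‖Φ d‖) (by positivity) (fun c => by
      rw [LinearMap.comp_apply, ← hgr]
      calc _ ≤ ‖Φ d‖ * ‖Φ (t c)‖ := h.form_le _ _
        _ ≤ ‖Φ d‖ * (Λ * ‖c‖) := by gcongr; exact hΛs c
        _ = _ := by ring)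
    rw [← hgr] at h1
    have h2 : (⟪J (Φ d), Φ d⟫).re ≤ ‖Φ d‖ ^ 2 := by
      rw [sq]; exact (Complex.re_le_norm _).trans (h.form_le _ _)
    have h3 : ‖Φ' d‖ ^ 2 ≤ (C * (1 + 4 * Λ ^ 2)) * ‖Φ d‖ ^ 2 := by
      refine h1.trans ?_
      calc _ ≤ C * (‖Φ d‖ ^ 2 + 2 / (1 / 2) * (Λ * ‖Φ d‖) ^ 2) := by gcongr
        _ = _ := by ring
    rw [← Real.sqrt_sq (norm_nonneg (Φ d)), ← Real.sqrt_mul (by positivity)]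
    exact Real.le_sqrt_of_sq_le h3
  set W : X →L[ℂ] X' := Φ'.extendOfNorm Φ with hW
  have hWΦ : ∀ d, W (Φ d) = Φ' d := fun d => LinearMap.extendOfNorm_eq hdense hbd d
  have hiso : ∀ x y, ⟪J' (W x), W y⟫ = ⟪J x, y⟫ := by
    intro x y
    refine hdense.induction_on₂ (p := fun x y => ⟪J' (W x), W y⟫ = ⟪J x, y⟫) ?_ ?_ x y
    · apply isClosed_eq <;> fun_prop
    · intro c d
      rw [hWΦ, hWΦ, hgr]
  let V : X' →L[ℂ] X := J ∘L (ContinuousLinearMap.adjoint W) ∘L J'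
  have hV : ∀ x a, ⟪J (V x), a⟫ = ⟪J' x, W a⟫ := by
    intro x a
    simp only [V, ContinuousLinearMap.comp_apply, h.inv, ContinuousLinearMap.adjoint_inner_left]
  refine ⟨V, fun x a => ?_, fun x => ?_⟩
  · rw [hV]
    have := hWΦ (Finsupp.single a 1)
    simp only [hΦ, hΦ', Finsupp.linearCombination_single, one_smul] at this
    rw [this]
  · have hz : ∀ a, ⟪J' (x - W (V x)), W a⟫ = 0 := by
      intro a
      rw [map_sub, inner_sub_left, hiso, hV, sub_self]
    have h1 := hb (x - W (V x)) 0 le_rfl (fun c => by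
      rw [LinearMap.comp_apply, ← hWΦ, hz]; simp)
    have h2 : 0 ≤ (⟪J' (x - W (V x)), x - W (V x)⟫).re := by
      have h3 : 0 ≤ C * ((⟪J' (x - W (V x)), x - W (V x)⟫).re + 2 / (1 / 2) * 0 ^ 2) :=
        le_trans (by positivity) h1
      have h4 := nonneg_of_mul_nonneg_right h3 hC
      simpa using h4
    have h5 := h'.form_add (x - W (V x)) (W (V x))
    rw [hz, hiso] at h5
    simp only [sub_add_cancel, Complex.zero_re] at h5
    linarith

/-- two total families with the same Gram matrix: isometric isomorphism. -/
theorem exists_iso {J : X →L[ℂ] X} {J' : X' →L[ℂ] X'} (h : Pont J) (h' : Pont J')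
    {k : ι → X} {k' : ι → X'}
    (hk : ∀ x, (∀ a, ⟪J x, k a⟫ = 0) → x = 0)
    (hk' : ∀ x, (∀ a, ⟪J' x, k' a⟫ = 0) → x = 0)
    (gram : ∀ a b, ⟪J (k a), k b⟫ = ⟪J' (k' a), k' b⟫) :
    ∃ V : X' ≃ₗ[ℂ] X, (∀ x a, ⟪J (V x), k a⟫ = ⟪J' x, k' a⟫) ∧
      ∀ x y, ⟪J (V x), V y⟫ = ⟪J' x, y⟫ := by
  have i1 := index_le h h' hk gram
  have i2 := index_le h' h hk' (fun a b => (gram a b).symm)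
  obtain ⟨V, hV, -⟩ := exists_contr h h' hk gram i2
  obtain ⟨V', hV', -⟩ := exists_contr h' h hk' (fun a b => (gram a b).symm) i1
  have e1 : ∀ x, V (V' x) = x := fun x => by
    rw [← sub_eq_zero]; apply hk; intro a
    rw [map_sub, inner_sub_left, hV, hV', sub_self]
  have e2 : ∀ x, V' (V x) = x := fun x => by
    rw [← sub_eq_zero]; apply hk'; intro a
    rw [map_sub, inner_sub_left, hV', hV, sub_self]
  have e3 : ∀ a, V (k' a) = k a := fun a => by
    rw [← sub_eq_zero]; apply hk; intro b
    rw [map_sub, inner_sub_left, hV, gram, sub_self]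
  refine ⟨LinearEquiv.ofLinearMap (V : X' →ₗ[ℂ] X) (V' : X →ₗ[ℂ] X')
    (LinearMap.ext e1) (LinearMap.ext e2), hV, fun x y => ?_⟩
  change ⟪J (V x), V y⟫ = ⟪J' x, y⟫
  have hdense : DenseRange (Finsupp.linearCombination ℂ k') := h'.dense hk'
  refine hdense.induction_on (p := fun y => ⟪J (V x), V y⟫ = ⟪J' x, y⟫) y ?_ ?_
  · apply isClosed_eq <;> fun_prop
  · intro c
    simp only [Finsupp.linearCombination_apply, Finsupp.sum, map_sum, map_smul,
      inner_sum, inner_smul_right, e3, hV]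

end Families

section ProdGeom

variable {X₁ X₂ : Type*} [NormedAddCommGroup X₁] [InnerProductSpace ℂ X₁] [CompleteSpace X₁]
  [NormedAddCommGroup X₂] [InnerProductSpace ℂ X₂] [CompleteSpace X₂]

theorem prodJ_form (J₁ : X₁ →L[ℂ] X₁) (J₂ : X₂ →L[ℂ] X₂) (x y : ProdState X₁ X₂) :
    ⟪prodJ J₁ J₂ x, y⟫ = ⟪J₁ x.fst, y.fst⟫ + ⟪J₂ x.snd, y.snd⟫ := by
  rw [WithLp.prod_inner_apply]; rfl

theorem prodJ_fst (J₁ : X₁ →L[ℂ] X₁) (J₂ : X₂ →L[ℂ] X₂) (x : ProdState X₁ X₂) :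
    (prodJ J₁ J₂ x).fst = J₁ x.fst := rfl

theorem prodJ_snd (J₁ : X₁ →L[ℂ] X₁) (J₂ : X₂ →L[ℂ] X₂) (x : ProdState X₁ X₂) :
    (prodJ J₁ J₂ x).snd = J₂ x.snd := rfl

theorem prodState_ext {x y : ProdState X₁ X₂} (h1 : x.fst = y.fst) (h2 : x.snd = y.snd) :
    x = y := by
  apply WithLp.ofLp_injective
  exact Prod.ext h1 h2

/-- the negative eigenspace of a product. -/
def negKprod (J₁ : X₁ →L[ℂ] X₁) (J₂ : X₂ →L[ℂ] X₂) :
    negK (prodJ J₁ J₂) ≃ₗ[ℂ] (negK J₁ × negK J₂) where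
  toFun x := (⟨x.1.fst, by
      have := congrArg WithLp.fst (LinearMap.mem_ker.1 x.2)
      exact this⟩, ⟨x.1.snd, by
      have := congrArg WithLp.snd (LinearMap.mem_ker.1 x.2)
      exact this⟩)
  invFun p := ⟨WithLp.toLp 2 (p.1.1, p.2.1), by
    rw [LinearMap.mem_ker]
    exact prodState_ext (LinearMap.mem_ker.1 p.1.2) (LinearMap.mem_ker.1 p.2.2)⟩
  map_add' x y := rfl
  map_smul' c x := rfl
  left_inv x := rfl
  right_inv p := rfl

theorem Pont.prod {J₁ : X₁ →L[ℂ] X₁} {J₂ : X₂ →L[ℂ] X₂} (h₁ : Pont J₁) (h₂ : Pont J₂) :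
    Pont (prodJ J₁ J₂) where
  sa x y := by
    rw [prodJ_form, WithLp.prod_inner_apply, h₁.sa, h₂.sa]; rfl
  inv x := prodState_ext (h₁.inv _) (h₂.inv _)
  fin := by
    have := h₁.fin
    have := h₂.fin
    exact Module.Finite.equiv (negKprod J₁ J₂).symm

theorem negK_id : negK (ContinuousLinearMap.id ℂ X₁) = ⊥ := by
  rw [Submodule.eq_bot_iff]
  intro x hx
  have h1 : x + x = 0 := LinearMap.mem_ker.1 hx
  have h2 : (2 : ℂ) • x = 0 := by rw [two_smul]; exact h1
  simpa using h2

theorem pont_id : Pont (ContinuousLinearMap.id ℂ X₁) where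
  sa x y := rfl
  inv x := rfl
  fin := by rw [negK_id]; infer_instance

theorem finrank_prod_id {J : X₁ →L[ℂ] X₁} (h : Pont J) :
    Module.finrank ℂ (negK (prodJ J (ContinuousLinearMap.id ℂ X₂)))
      = Module.finrank ℂ (negK J) := by
  have := h.fin
  have := (pont_id (X₁ := X₂)).fin
  rw [(negKprod J (ContinuousLinearMap.id ℂ X₂)).finrank_eq, Module.finrank_prod, negK_id]
  simp

end ProdGeom

section Kernel

variable {U Y : Type*} [NormedAddCommGroup U] [InnerProductSpace ℂ U] [CompleteSpace U]
  [NormedAddCommGroup Y] [InnerProductSpace ℂ Y] [CompleteSpace Y]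
  {H : Type*} [NormedAddCommGroup H] [InnerProductSpace ℂ H] [CompleteSpace H]

theorem one_sub_ne {z w : ℂ} (hz : ‖z‖ < 1) (hw : ‖w‖ < 1) : 1 - z * conj w ≠ 0 := by
  intro h
  have h1 : z * conj w = 1 := (sub_eq_zero.1 h).symm
  have h2 : ‖z‖ * ‖w‖ = 1 := by
    have := congrArg norm h1
    simpa using this
  nlinarith [norm_nonneg z, norm_nonneg w]

theorem pont_of_gram {S : ℂ → (U →L[ℂ] Y)} {Ω Ω' : Set ℂ} {κ : ℕ} (hS : MemGenSchur S Ω κ)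
    (hsub : Ω' ⊆ Ω) {J : H →L[ℂ] H} (hJ : IsFundamentalSymmetry J κ) (k : ℂ → Y → H)
    (gram : ∀ w ∈ Ω', ∀ v ∈ Ω', ∀ f g, ⟪J (k w f), k v g⟫ = ⟪schurKernel S w v f, g⟫)
    (tot : ∀ h, (∀ w ∈ Ω', ∀ f, ⟪J h, k w f⟫ = 0) → h = 0) : Pont J := by
  obtain ⟨hsa, hinv, hfr⟩ := hJ
  have sa : ∀ x y, ⟪J x, y⟫ = ⟪x, J y⟫ := fun x y => by
    rw [← ContinuousLinearMap.adjoint_inner_right, hsa.adjoint_eq]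
  have inv : ∀ x, J (J x) = x := fun x => by
    have := congrArg (fun T : H →L[ℂ] H => T x) hinv
    simpa using this
  refine ⟨sa, inv, ?_⟩
  rcases Nat.eq_zero_or_pos κ with h0 | hpos
  swap
  · exact Module.finite_of_finrank_pos (by rw [hfr]; exact hpos)
  subst h0
  -- the form is nonnegative on the span
  have hspan : ∀ x ∈ Submodule.span ℂ (Set.range fun a : Ω' × Y => k a.1 a.2),
      0 ≤ (⟪J x, x⟫).re := by
    intro x hx
    rw [Submodule.mem_span_set'] at hx
    obtain ⟨n, c, g, rfl⟩ := hx
    choose a ha using fun i => (g i).2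
    by_contra hneg
    push Not at hneg
    have hform : ∀ t : ℂ, (∑ i, ∑ j, (starRingEnd ℂ ((t • fun i => conj (c i)) i)) *
        (t • fun i => conj (c i)) j *
        ⟪schurKernel S (a j).1 (a i).1 (a j).2, (a i).2⟫)
        = (‖t‖ ^ 2 : ℝ) * ⟪J (∑ i, c i • (g i : H)), ∑ i, c i • (g i : H)⟫ := by
      intro t
      simp only [map_sum, map_smul, inner_sum, sum_inner, inner_smul_left, inner_smul_right,
        Finset.mul_sum, ← ha]
      refine Finset.sum_congr rfl fun i _ => Finset.sum_congr rfl fun j _ => ?_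
      rw [gram _ (a j).1.2 _ (a i).1.2]
      have : ((‖t‖ ^ 2 : ℝ) : ℂ) = conj t * t := by
        rw [Complex.conj_mul']; norm_cast
      rw [this]
      simp only [Pi.smul_apply, smul_eq_mul, map_mul, Complex.conj_conj]
      ring
    have hc : (fun i => conj (c i)) ≠ 0 := by
      intro h
      have : ∀ i, c i = 0 := fun i => by
        have := congrFun h i
        simpa using this
      simp [this] at hneg
    have := hS.negSq_le n (fun i => (a i).1) (fun i => hsub (a i).1.2) (fun i => (a i).2)
      (Submodule.span ℂ {fun i => conj (c i)}) (by
        intro c' hc' hne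
        obtain ⟨t, rfl⟩ := Submodule.mem_span_singleton.1 hc'
        rw [hform, Complex.re_ofReal_mul]
        have ht : t ≠ 0 := by rintro rfl; simp at hne
        have : 0 < ‖t‖ := norm_pos_iff.2 ht
        exact mul_neg_of_pos_of_neg (by positivity) hneg)
    rw [finrank_span_singleton hc] at this
    omega
  have hd : Dense ((Submodule.span ℂ (Set.range fun a : Ω' × Y => k a.1 a.2) :
      Submodule ℂ H) : Set H) := by
    rw [Submodule.dense_iff_topologicalClosure_eq_top,
      Submodule.topologicalClosure_eq_top_iff, Submodule.eq_bot_iff]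
    intro x hx
    have h1 : J x = 0 := by
      apply tot
      intro w hw f
      rw [inv]
      rw [Submodule.mem_orthogonal'] at hx
      exact hx _ (Submodule.subset_span ⟨(⟨w, hw⟩, f), rfl⟩)
    rw [← inv x, h1, map_zero]
  have hall : ∀ x, 0 ≤ (⟪J x, x⟫).re := by
    intro x
    have hcl : IsClosed {x : H | 0 ≤ (⟪J x, x⟫).re} :=
      isClosed_le continuous_const (Complex.continuous_re.comp (by fun_prop))
    exact hcl.closure_subset_iff.2 hspan (hd x)
  have hbot : negK J = ⊥ := by
    rw [Submodule.eq_bot_iff]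
    intro x hx
    have h1 : J x = -x := eq_neg_of_add_eq_zero_left (LinearMap.mem_ker.1 hx)
    have h2 := hall x
    rw [h1, inner_neg_left, inner_self_eq_norm_sq_to_K] at h2
    have h3 : 0 ≤ -(‖x‖ ^ 2) := by
      have : (-((‖x‖ : ℂ)) ^ 2).re = -(‖x‖ ^ 2) := by norm_cast
      rw [← this]; exact h2
    have h4 : ‖x‖ ^ 2 = 0 := le_antisymm (by linarith) (by positivity)
    simpa using h4
  rw [hbot]; infer_instance

/-- working form of the reproducing kernel property. -/
structure RK (S : ℂ → (U →L[ℂ] Y)) (Ω : Set ℂ) (J : H →L[ℂ] H) (ev : H →ₗ[ℂ] (ℂ → Y))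
    (k : ℂ → Y → H) : Prop where
  pont : Pont J
  repro : ∀ w ∈ Ω, ∀ f h, ⟪J h, k w f⟫ = ⟪ev h w, f⟫
  evk : ∀ w ∈ Ω, ∀ f, ∀ z ∈ Ω, ev (k w f) z = schurKernel S w z f
  sep : ∀ h : H, (∀ z ∈ Ω, ev h z = 0) → h = 0

theorem RK.gram {S : ℂ → (U →L[ℂ] Y)} {Ω : Set ℂ} {J : H →L[ℂ] H} {ev : H →ₗ[ℂ] (ℂ → Y)}
    {k : ℂ → Y → H} (h : RK S Ω J ev k) {w v : ℂ} (hw : w ∈ Ω) (hv : v ∈ Ω) (f g : Y) :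
    ⟪J (k w f), k v g⟫ = ⟪schurKernel S w v f, g⟫ := by
  rw [h.repro v hv, h.evk w hw f v hv]

theorem IsRKPS.rk {S : ℂ → (U →L[ℂ] Y)} {Ω : Set ℂ} {κ : ℕ} (hS : MemGenSchur S Ω κ)
    {J : H →L[ℂ] H} {ev : H →ₗ[ℂ] (ℂ → Y)} (h : IsRKPS S Ω κ J ev) :
    ∃ k, RK S Ω J ev k := by
  classical
  have := h.repro
  choose! k hk hk' using this
  have tot : ∀ x, (∀ w ∈ Ω, ∀ f, ⟪J x, k w f⟫ = 0) → x = 0 := by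
    intro x hx
    apply h.sep
    intro z hz
    have := hx z hz (ev x z)
    rw [hk' z hz] at this
    exact inner_self_eq_zero.1 this
  refine ⟨k, pont_of_gram hS subset_rfl h.fund k ?_ tot, fun w hw f x => hk' w hw f x,
    fun w hw f z hz => hk w hw f z hz, h.sep⟩
  intro w hw v hv f g
  rw [hk' v hv, hk w hw f v hv]

theorem RK.tot {S : ℂ → (U →L[ℂ] Y)} {Ω : Set ℂ} {J : H →L[ℂ] H} {ev : H →ₗ[ℂ] (ℂ → Y)}
    {k : ℂ → Y → H} (h : RK S Ω J ev k) (x : H) (hx : ∀ w ∈ Ω, ∀ f, ⟪J x, k w f⟫ = 0) :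
    x = 0 := by
  apply h.sep
  intro z hz
  have := hx z hz (ev x z)
  rw [h.repro z hz] at this
  exact inner_self_eq_zero.1 this

theorem kernel_cont {S : ℂ → (U →L[ℂ] Y)} {Ω : Set ℂ} (hΩ : IsOpen Ω)
    (hsub : Ω ⊆ ball (0 : ℂ) 1) (hS : ContinuousOn S Ω) {w z : ℂ} (hw : w ∈ Ω) (hz : z ∈ Ω) :
    ContinuousAt (fun p : ℂ × ℂ => schurKernel S p.1 p.2) (w, z) := by
  unfold schurKernel
  have hw1 : ‖w‖ < 1 := by simpa using hsub hw
  have hz1 : ‖z‖ < 1 := by simpa using hsub hz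
  have c1 : ContinuousAt (fun p : ℂ × ℂ => S p.1) (w, z) :=
    ContinuousAt.comp (f := Prod.fst) (hS.continuousAt (hΩ.mem_nhds hw)) continuousAt_fst
  have c2 : ContinuousAt (fun p : ℂ × ℂ => S p.2) (w, z) :=
    ContinuousAt.comp (f := Prod.snd) (hS.continuousAt (hΩ.mem_nhds hz)) continuousAt_snd
  have c3 : ContinuousAt (fun p : ℂ × ℂ => ContinuousLinearMap.adjoint (S p.1)) (w, z) :=
    (ContinuousLinearMap.adjoint (𝕜 := ℂ) (E := U) (F := Y)).continuous.continuousAt.comp c1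
  have c4 : ContinuousAt (fun p : ℂ × ℂ => 1 - p.2 * conj p.1) (w, z) := by fun_prop
  exact (c4.inv₀ (one_sub_ne hz1 hw1)).smul (continuousAt_const.sub (c2.clm_comp c3))

theorem RK.cont {S : ℂ → (U →L[ℂ] Y)} {Ω : Set ℂ} {J : H →L[ℂ] H} {ev : H →ₗ[ℂ] (ℂ → Y)}
    {k : ℂ → Y → H} (h : RK S Ω J ev k) (hΩ : IsOpen Ω)
    (hsub : Ω ⊆ ball (0 : ℂ) 1) (hS : ContinuousOn S Ω) {w₀ : ℂ} (hw₀ : w₀ ∈ Ω) (x : H) (f : Y) :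
    ContinuousAt (fun w => ⟪ev x w, f⟫) w₀ := by
  have P := h.pont
  have hmem : ∀ᶠ w in 𝓝 w₀, w ∈ Ω := hΩ.mem_nhds hw₀
  have key : Tendsto (fun w => k w f - k w₀ f) (𝓝 w₀) (𝓝 0) := by
    have hd := P.dense (k := fun a : Ω × Y => k a.1 a.2) (fun x hx =>
      h.tot x fun w hw f => hx (⟨w, hw⟩, f))
    obtain ⟨s, hsD, hs⟩ := P.exists_neg hd
    obtain ⟨C, hC, hb⟩ := P.neg_bound le_rfl s (by norm_num : (0:ℝ) < 1 / 2) hs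
    -- pairing with the span
    have hkv : ∀ v ∈ Ω, ∀ g, Tendsto (fun w => ⟪J (k w f - k w₀ f), k v g⟫) (𝓝 w₀) (𝓝 0) := by
      intro v hv g
      have c1 : ContinuousAt (fun w => ⟪schurKernel S w v f, g⟫) w₀ := by
        have := ContinuousAt.comp (f := fun w : ℂ => (w, v)) (x := w₀)
          (kernel_cont hΩ hsub hS hw₀ hv) (by fun_prop)
        exact ContinuousAt.inner (𝕜 := ℂ) (this.clm_apply continuousAt_const) continuousAt_const
      have c2 := (c1.sub (continuousAt_const (y := ⟪schurKernel S w₀ v f, g⟫))).tendsto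
      simp only [Pi.sub_apply, sub_self] at c2
      refine c2.congr' ?_
      filter_upwards [hmem] with w hw
      rw [map_sub, inner_sub_left, h.gram hw hv, h.gram hw₀ hv]
      rfl
    have hkd : ∀ d ∈ LinearMap.range (Finsupp.linearCombination ℂ (fun a : Ω × Y => k a.1 a.2)),
        Tendsto (fun w => ⟪J (k w f - k w₀ f), d⟫) (𝓝 w₀) (𝓝 0) := by
      intro d hd
      rw [Finsupp.range_linearCombination] at hd
      induction hd using Submodule.span_induction with
      | mem x hx =>
        obtain ⟨a, rfl⟩ := hx
        exact hkv _ a.1.2 _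
      | zero => simp
      | add x y _ _ hx hy => simpa [inner_add_right] using hx.add hy
      | smul c x _ hx => simpa [inner_smul_right] using hx.const_mul c
    let b : ℂ → ℝ := fun w => ∑ i, ‖⟪J (k w f - k w₀ f), s (EuclideanSpace.single i 1)⟫‖
    have hb0 : Tendsto b (𝓝 w₀) (𝓝 0) := by
      have : Tendsto b (𝓝 w₀) (𝓝 (∑ i : Fin (Module.finrank ℂ (negK J)), ‖(0:ℂ)‖)) :=
        tendsto_finsetSum _ fun i _ => (hkd _ (hsD _)).norm
      simpa using this
    have hbs : ∀ w c, ‖⟪J (k w f - k w₀ f), s c⟫‖ ≤ b w * ‖c‖ := by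
      intro w c
      have hc : c = ∑ i, c i • (EuclideanSpace.single i (1:ℂ)) := by
        ext j; simp [Finset.sum_apply, Pi.single_apply]
      conv_lhs => rw [hc]
      simp only [map_sum, map_smul, inner_sum, inner_smul_right, b, Finset.sum_mul]
      refine (norm_sum_le _ _).trans (Finset.sum_le_sum fun i _ => ?_)
      rw [norm_mul, mul_comm]
      gcongr
      exact PiLp.norm_apply_le c i
    have hq : Tendsto (fun w => (⟪J (k w f - k w₀ f), k w f - k w₀ f⟫).re) (𝓝 w₀) (𝓝 0) := by
      have c1 : ContinuousAt (fun w => ⟪schurKernel S w w f, f⟫) w₀ := by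
        have := ContinuousAt.comp (f := fun w : ℂ => (w, w)) (x := w₀)
          (kernel_cont hΩ hsub hS hw₀ hw₀) (by fun_prop)
        exact ContinuousAt.inner (𝕜 := ℂ) (this.clm_apply continuousAt_const) continuousAt_const
      have c2 : ContinuousAt (fun w => ⟪schurKernel S w₀ w f, f⟫) w₀ := by
        have := ContinuousAt.comp (f := fun w : ℂ => (w₀, w)) (x := w₀)
          (kernel_cont hΩ hsub hS hw₀ hw₀) (by fun_prop)
        exact ContinuousAt.inner (𝕜 := ℂ) (this.clm_apply continuousAt_const) continuousAt_const
      have c3 := (c1.sub c2).tendsto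
      have c4 := c3.sub (hkv w₀ hw₀ f)
      simp only [Pi.sub_apply, sub_self] at c4
      have c5 := (Complex.continuous_re.tendsto _).comp c4
      simp only [Complex.zero_re] at c5
      refine c5.congr' ?_
      filter_upwards [hmem] with w hw
      simp only [Function.comp]
      congr 1
      simp only [map_sub, inner_sub_left, inner_sub_right, h.gram hw hw₀, h.gram hw hw,
        h.gram hw₀ hw]
    have hlim : Tendsto (fun w => C * ((⟪J (k w f - k w₀ f), k w f - k w₀ f⟫).re
        + 2 / (1 / 2) * b w ^ 2)) (𝓝 w₀) (𝓝 0) := by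
      have := (hq.add ((hb0.pow 2).const_mul (2 / (1 / 2)))).const_mul C
      simpa using this
    have hsq : Tendsto (fun w => ‖k w f - k w₀ f‖ ^ 2) (𝓝 w₀) (𝓝 0) :=
      squeeze_zero (fun w => by positivity)
        (fun w => hb _ (b w) (Finset.sum_nonneg fun i _ => norm_nonneg _) (hbs w)) hlim
    have := (Real.continuous_sqrt.tendsto 0).comp hsq
    rw [tendsto_zero_iff_norm_tendsto_zero]
    simpa [Function.comp_def, Real.sqrt_sq] using this
  have key2 : Tendsto (fun w => k w f) (𝓝 w₀) (𝓝 (k w₀ f)) := by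
    have := key.add_const (k w₀ f)
    simpa using this
  have : Tendsto (fun w => ⟪J x, k w f⟫) (𝓝 w₀) (𝓝 ⟪J x, k w₀ f⟫) :=
    Filter.Tendsto.inner tendsto_const_nhds key2
  rw [h.repro w₀ hw₀] at this
  refine Tendsto.congr' ?_ this
  filter_upwards [hmem] with w hw
  rw [h.repro w hw]

end Kernel

section Shift

variable {U Y : Type*} [NormedAddCommGroup U] [InnerProductSpace ℂ U] [CompleteSpace U]
  [NormedAddCommGroup Y] [InnerProductSpace ℂ Y] [CompleteSpace Y]
  {H : Type*} [NormedAddCommGroup H] [InnerProductSpace ℂ H] [CompleteSpace H]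

theorem kernel_id (S : ℂ → (U →L[ℂ] Y)) {w v : ℂ} (hw : ‖w‖ < 1) (hv : ‖v‖ < 1) (f g : Y) :
    (1 - w * conj v) * ⟪schurKernel S w v f, g⟫
      = ⟪f, g⟫ - ⟪ContinuousLinearMap.adjoint (S w) f, ContinuousLinearMap.adjoint (S v) g⟫ := by
  have hne := one_sub_ne hw hv
  unfold schurKernel
  rw [smul_apply, inner_smul_left]
  have h1 : conj ((1 - v * conj w)⁻¹) = (1 - w * conj v)⁻¹ := by
    simp [mul_comm]
  rw [h1, ← mul_assoc, mul_inv_cancel₀ hne, one_mul, sub_apply,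
    inner_sub_left, ContinuousLinearMap.adjoint_inner_right]
  rfl

theorem ev_eq_zero_of_cont {ev : ℂ → Y} {w₀ : ℂ}
    (hc : ∀ f, ContinuousAt (fun w => ⟪ev w, f⟫) w₀) (h : ∀ᶠ w in 𝓝[≠] w₀, ev w = 0) :
    ev w₀ = 0 := by
  have h1 : Tendsto (fun w => ⟪ev w, ev w₀⟫) (𝓝[≠] w₀) (𝓝 ⟪ev w₀, ev w₀⟫) :=
    (hc (ev w₀)).tendsto.mono_left nhdsWithin_le_nhds
  have h2 : Tendsto (fun w => ⟪ev w, ev w₀⟫) (𝓝[≠] w₀) (𝓝 0) := by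
    refine tendsto_const_nhds.congr' ?_
    filter_upwards [h] with w hw
    simp [hw]
  exact inner_self_eq_zero.1 (tendsto_nhds_unique h1 h2)

theorem RK.shift {S : ℂ → (U →L[ℂ] Y)} {Ω : Set ℂ} {J : H →L[ℂ] H} {ev : H →ₗ[ℂ] (ℂ → Y)}
    {k : ℂ → Y → H} (h : RK S Ω J ev k) (hΩ : IsOpen Ω) (h0 : (0 : ℂ) ∈ Ω)
    (hsub : Ω ⊆ ball (0 : ℂ) 1) (hS : ContinuousOn S Ω) :
    ∃ R : H →ₗ[ℂ] H, ∀ x, ev x 0 = 0 → (∀ w ∈ Ω, w • ev (R x) w = ev x w) ∧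
      (⟪J (R x), R x⟫).re ≤ (⟪J x, x⟫).re := by
  have P := h.pont
  have nlt : ∀ w ∈ Ω, ‖w‖ < 1 := fun w hw => by simpa using hsub hw
  let ka : Ω × Y → ProdState H Y := fun a => WithLp.toLp 2 ((conj a.1.1) • k a.1.1 a.2, a.2)
  let kb : Ω × Y → ProdState H U := fun a =>
    WithLp.toLp 2 (k a.1.1 a.2, ContinuousLinearMap.adjoint (S a.1.1) a.2)
  have hka : ∀ (x : ProdState H Y) (w : ℂ) (hw : w ∈ Ω) (f : Y),
      ⟪prodJ J (ContinuousLinearMap.id ℂ Y) x, ka (⟨w, hw⟩, f)⟫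
        = ⟪w • ev x.fst w + x.snd, f⟫ := by
    intro x w hw f
    rw [prodJ_form, inner_add_left, inner_smul_left, ← h.repro w hw]
    simp only [ka, WithLp.toLp_fst, WithLp.toLp_snd]
    rw [inner_smul_right]
    rfl
  have hkb : ∀ (x : ProdState H U) (w : ℂ) (hw : w ∈ Ω) (f : Y),
      ⟪prodJ J (ContinuousLinearMap.id ℂ U) x, kb (⟨w, hw⟩, f)⟫
        = ⟪ev x.fst w, f⟫ + ⟪x.snd, ContinuousLinearMap.adjoint (S w) f⟫ := by
    intro x w hw f
    rw [prodJ_form, ← h.repro w hw]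
    rfl
  have tot : ∀ x : ProdState H Y,
      (∀ a, ⟪prodJ J (ContinuousLinearMap.id ℂ Y) x, ka a⟫ = 0) → x = 0 := by
    intro x hx
    have h1 : ∀ w ∈ Ω, w • ev x.fst w + x.snd = 0 := by
      intro w hw
      have := hx (⟨w, hw⟩, w • ev x.fst w + x.snd)
      rw [hka] at this
      exact inner_self_eq_zero.1 this
    have h2 : x.snd = 0 := by simpa using h1 0 h0
    have h3 : ∀ w ∈ Ω, w ≠ 0 → ev x.fst w = 0 := by
      intro w hw hne
      have := h1 w hw
      rw [h2, add_zero] at this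
      exact (smul_eq_zero.1 this).resolve_left hne
    have h4 : ev x.fst 0 = 0 := by
      refine ev_eq_zero_of_cont (fun f => h.cont hΩ hsub hS h0 x.fst f) ?_
      rw [eventually_nhdsWithin_iff]
      filter_upwards [hΩ.mem_nhds h0] with w hw hne
      exact h3 w hw hne
    have h5 : x.fst = 0 := by
      apply h.sep
      intro z hz
      by_cases hz0 : z = 0
      · rw [hz0, h4]
      · exact h3 z hz hz0
    exact prodState_ext h5 h2
  obtain ⟨V, hV, hVle⟩ := exists_contr (k := ka) (k' := kb) (P.prod (pont_id (X₁ := Y)))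
    (P.prod (pont_id (X₁ := U))) tot (by
      rintro ⟨⟨w, hw⟩, f⟩ ⟨⟨v, hv⟩, g⟩
      rw [hka, hkb]
      simp only [ka, kb, WithLp.toLp_fst, WithLp.toLp_snd]
      rw [map_smul, Pi.smul_apply, h.evk w hw f v hv, inner_add_left, inner_smul_left,
        inner_smul_left]
      have := kernel_id S (nlt w hw) (nlt v hv) f g
      simp only [Complex.conj_conj]
      linear_combination -this)
    (by rw [finrank_prod_id P, finrank_prod_id P])
  let i : H →ₗ[ℂ] ProdState H U :=
    { toFun := fun x => WithLp.toLp 2 (x, 0)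
      map_add' := fun x y => prodState_ext rfl (by simp)
      map_smul' := fun c x => prodState_ext rfl (by simp) }
  let p : ProdState H Y →ₗ[ℂ] H :=
    { toFun := fun x => x.fst
      map_add' := fun x y => rfl
      map_smul' := fun c x => rfl }
  refine ⟨p ∘ₗ V.toLinearMap ∘ₗ i, fun x hx => ?_⟩
  have e1 : ∀ w ∈ Ω, w • ev (V (i x)).fst w + (V (i x)).snd = ev x w := by
    intro w hw
    refine ext_inner_right ℂ fun f => ?_
    rw [← hka _ w hw, hV, hkb]
    have : (i x).snd = 0 := rfl
    rw [this, inner_zero_left, add_zero]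
    rfl
  have e2 : (V (i x)).snd = 0 := by
    have := e1 0 h0
    rw [hx, zero_smul, zero_add] at this
    exact this
  refine ⟨fun w hw => ?_, ?_⟩
  · have := e1 w hw
    rw [e2, add_zero] at this
    exact this
  · have := hVle (i x)
    rw [prodJ_form, prodJ_form, e2] at this
    have h6 : (i x).snd = 0 := rfl
    rw [h6] at this
    simp only [inner_zero_right, add_zero] at this
    exact this

end Shift

section Van

variable {U Y : Type*} [NormedAddCommGroup U] [InnerProductSpace ℂ U] [CompleteSpace U]
  [NormedAddCommGroup Y] [InnerProductSpace ℂ Y] [CompleteSpace Y]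
  {H : Type*} [NormedAddCommGroup H] [InnerProductSpace ℂ H] [CompleteSpace H]

/-- an element of the reproducing kernel space whose function vanishes near `0` is `0`. -/
theorem RK.van {S : ℂ → (U →L[ℂ] Y)} {Ω : Set ℂ} {J : H →L[ℂ] H} {ev : H →ₗ[ℂ] (ℂ → Y)}
    {k : ℂ → Y → H} (h : RK S Ω J ev k) (hΩ : IsOpen Ω) (h0 : (0 : ℂ) ∈ Ω)
    (hsub : Ω ⊆ ball (0 : ℂ) 1) (hS : ContinuousOn S Ω) (x : H)
    (hx : ∀ᶠ z in 𝓝 (0 : ℂ), ev x z = 0) : x = 0 := by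
  have P := h.pont
  have nlt : ∀ w ∈ Ω, ‖w‖ < 1 := fun w hw => by simpa using hsub hw
  obtain ⟨R, hR⟩ := h.shift hΩ h0 hsub hS
  let N : Submodule ℂ H :=
    { carrier := {y | ∀ᶠ z in 𝓝 (0 : ℂ), ev y z = 0}
      zero_mem' := by simp
      add_mem' := by
        intro a b ha hb
        simp only [Set.mem_ofPred_eq] at ha hb ⊢
        filter_upwards [ha, hb] with z h1 h2
        simp [h1, h2]
      smul_mem' := by
        intro c a ha
        simp only [Set.mem_ofPred_eq] at ha ⊢
        filter_upwards [ha] with z h1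
        simp [h1] }
  have hN : ∀ y ∈ N, R y ∈ N ∧ (∀ w ∈ Ω, w • ev (R y) w = ev y w) ∧
      (⟪J (R y), R y⟫).re ≤ (⟪J y, y⟫).re := by
    intro y hy
    have hy' : ∀ᶠ z in 𝓝 (0 : ℂ), ev y z = 0 := hy
    obtain ⟨h1, h2⟩ := hR y hy'.self_of_nhds
    refine ⟨?_, h1, h2⟩
    have h3 : ∀ᶠ w in 𝓝 (0 : ℂ), w ≠ 0 → ev (R y) w = 0 := by
      filter_upwards [hy', hΩ.mem_nhds h0] with w hw hwΩ hne
      have := h1 w hwΩ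
      rw [hw] at this
      exact (smul_eq_zero.1 this).resolve_left hne
    have h4 : ev (R y) 0 = 0 := by
      refine ev_eq_zero_of_cont (fun f => h.cont hΩ hsub hS h0 (R y) f) ?_
      rw [eventually_nhdsWithin_iff]
      exact h3
    change ∀ᶠ z in 𝓝 (0 : ℂ), ev (R y) z = 0
    filter_upwards [h3] with w hw
    by_cases hw0 : w = 0
    · rw [hw0, h4]
    · exact hw hw0
  have hNn : ∀ n : ℕ, ∀ y ∈ N, (R ^ n) y ∈ N ∧ (∀ w ∈ Ω, w ^ n • ev ((R ^ n) y) w = ev y w) ∧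
      (⟪J ((R ^ n) y), (R ^ n) y⟫).re ≤ (⟪J y, y⟫).re := by
    intro n
    induction n with
    | zero => intro y hy; exact ⟨hy, fun w _ => by simp, le_rfl⟩
    | succ n ih =>
      intro y hy
      obtain ⟨i1, i2, i3⟩ := ih y hy
      obtain ⟨j1, j2, j3⟩ := hN _ i1
      have e : (R ^ (n + 1)) y = R ((R ^ n) y) := by rw [pow_succ']; rfl
      rw [e]
      refine ⟨j1, fun w hw => ?_, j3.trans i3⟩
      rw [pow_succ, mul_smul, j2 w hw, i2 w hw]
  apply h.sep
  intro z₀ hz₀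
  by_contra hne
  set f := ev x z₀ with hf
  have hx0 : ev x 0 = 0 := hx.self_of_nhds
  -- infinitely many points at which the function does not vanish
  have hnear : {z | z ∈ Ω ∧ ⟪ev x z, f⟫ ≠ 0} ∈ 𝓝 z₀ := by
    have h1 := (h.cont hΩ hsub hS hz₀ x f).eventually_ne (y := 0) (by
      rw [← hf]; exact fun hh => hne (inner_self_eq_zero.1 hh))
    filter_upwards [h1, hΩ.mem_nhds hz₀] with z h1 h2
    exact ⟨h2, h1⟩
  have hinf : {z | z ∈ Ω ∧ ⟪ev x z, f⟫ ≠ 0}.Infinite := infinite_of_mem_nhds z₀ hnear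
  let emb := hinf.natEmbedding
  let m := Module.finrank ℂ (negK J) + 1
  let z : Fin m → ℂ := fun i => (emb i).1
  have hzΩ : ∀ i, z i ∈ Ω := fun i => (emb i).2.1
  have hzf : ∀ i, ⟪ev x (z i), f⟫ ≠ 0 := fun i => (emb i).2.2
  have hzinj : Function.Injective z := by
    intro i j hij
    have := emb.injective (Subtype.ext hij)
    exact Fin.ext this
  have hz0 : ∀ i, z i ≠ 0 := by
    intro i hi
    apply hzf i
    rw [hi, hx0, inner_zero_left]
  let σ : EuclideanSpace ℂ (Fin m) →ₗ[ℂ] H :=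
    { toFun := fun c => ∑ j : Fin m, c j • (R ^ (j : ℕ)) x
      map_add' := fun c d => by simp [add_smul, Finset.sum_add_distrib]
      map_smul' := fun t c => by simp [mul_smul, Finset.smul_sum] }
  have hσ : ∀ c, σ c = ∑ j : Fin m, c j • (R ^ (j : ℕ)) x := fun c => rfl
  have hσN : ∀ c, σ c ∈ N := fun c => by
    rw [hσ]
    exact Submodule.sum_mem _ fun j _ => N.smul_mem _ (hNn j x hx).1
  let ψ : EuclideanSpace ℂ (Fin m) →ₗ[ℂ] (Fin m → ℂ) :=
    { toFun := fun c i => ⟪f, ev (σ c) (z i)⟫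
      map_add' := fun c d => by ext i; simp [inner_add_right]
      map_smul' := fun t c => by ext i; simp [inner_smul_right] }
  have hψ : ∀ c i, ψ c i = ⟪f, ev (σ c) (z i)⟫ := fun c i => rfl
  have hψinj : LinearMap.ker ψ = ⊥ := by
    rw [LinearMap.ker_eq_bot']
    intro c hc
    have h1 : ∀ i, ∑ j : Fin m, (z i)⁻¹ ^ (j : ℕ) * c j = 0 := by
      intro i
      have h2 : ⟪f, ev (σ c) (z i)⟫ = 0 := by rw [← hψ, hc]; rfl
      have h3 : ∀ j : ℕ, ev ((R ^ j) x) (z i) = (z i)⁻¹ ^ j • ev x (z i) := by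
        intro j
        rw [← (hNn j x hx).2.1 (z i) (hzΩ i), smul_smul, ← mul_pow, inv_mul_cancel₀ (hz0 i),
          one_pow, one_smul]
      have h4 : ev (σ c) (z i) = (∑ j : Fin m, (z i)⁻¹ ^ (j : ℕ) * c j) • ev x (z i) := by
        rw [hσ, map_sum, Finset.sum_apply, Finset.sum_smul]
        refine Finset.sum_congr rfl fun j _ => ?_
        rw [map_smul, Pi.smul_apply, h3, smul_smul, mul_comm]
      rw [h4, inner_smul_right] at h2
      refine (mul_eq_zero.1 h2).resolve_right ?_
      exact fun hh => hzf i (inner_eq_zero_symm.1 hh)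
    have h5 := Matrix.eq_zero_of_forall_index_sum_pow_mul_eq_zero
      (f := fun i => (z i)⁻¹) (v := fun j => c j) (fun i j hij => hzinj (inv_injective hij)) h1
    ext j
    exact congrFun h5 j
  obtain ⟨K, hK, hanti⟩ := LinearMap.exists_antilipschitzWith ψ hψinj
  have hKb : ∀ c, ‖c‖ ≤ K * ‖ψ c‖ := fun c => by
    have := hanti.le_mul_dist c 0
    simpa using this
  let σc := LinearMap.toContinuousLinearMap σ
  have hΛ : ∀ c, ‖σ c‖ ≤ ‖σc‖ * ‖c‖ := fun c => σc.le_opNorm c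
  obtain ⟨i₀, hi₀⟩ := Finite.exists_max (fun i => ‖z i‖)
  set r := ‖z i₀‖ with hr
  have hr1 : r < 1 := nlt _ (hzΩ i₀)
  have hr0 : 0 ≤ r := norm_nonneg _
  obtain ⟨i₁, hi₁⟩ := Finite.exists_max (fun i => ‖k (z i) f‖)
  set M := ‖k (z i₁) f‖ with hM
  have hM0 : 0 ≤ M := norm_nonneg _
  have hψb : ∀ n c, ‖ψ c‖ ≤ r ^ n * (‖(R ^ n) (σ c)‖ * M) := by
    intro n c
    rw [pi_norm_le_iff_of_nonneg (by positivity)]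
    intro i
    rw [hψ, ← (hNn n _ (hσN c)).2.1 (z i) (hzΩ i), inner_smul_right, norm_mul, norm_pow]
    have h1 : ‖⟪f, ev ((R ^ n) (σ c)) (z i)⟫‖ ≤ ‖(R ^ n) (σ c)‖ * M := by
      rw [← norm_inner_symm, ← h.repro _ (hzΩ i)]
      exact (P.form_le _ _).trans (mul_le_mul_of_nonneg_left (hi₁ i) (norm_nonneg _))
    gcongr
    exact hi₀ i
  have hlim : Tendsto (fun n : ℕ => ‖σc‖ * K * M * r ^ n) atTop (𝓝 0) := by
    have := (tendsto_pow_atTop_nhds_zero_of_lt_one hr0 hr1).const_mul (‖σc‖ * K * M)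
    simpa using this
  obtain ⟨n, hn⟩ := (hlim.eventually (gt_mem_nhds (show (0:ℝ) < 1 by norm_num))).exists
  have hfin : m ≤ Module.finrank ℂ (negK J) := by
    refine P.finrank_le ((R ^ n) ∘ₗ σ) fun c hc => ?_
    rw [LinearMap.comp_apply]
    set y := (R ^ n) (σ c) with hy
    have hcpos : 0 < ‖c‖ := norm_pos_iff.2 hc
    have b1 : ‖c‖ ≤ K * (r ^ n * (‖y‖ * M)) :=
      (hKb c).trans (mul_le_mul_of_nonneg_left (hψb n c) K.2)
    have hypos : 0 < ‖y‖ := by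
      rcases (norm_nonneg y).lt_or_eq with h1 | h1
      · exact h1
      · rw [← h1] at b1; simp at b1; exact absurd b1 hc
    have b2 : ‖σ c‖ < ‖y‖ := by
      calc ‖σ c‖ ≤ ‖σc‖ * ‖c‖ := hΛ c
        _ ≤ ‖σc‖ * (K * (r ^ n * (‖y‖ * M))) := by gcongr
        _ = (‖σc‖ * K * M * r ^ n) * ‖y‖ := by ring
        _ < 1 * ‖y‖ := by gcongr
        _ = ‖y‖ := one_mul _
    calc (⟪J y, y⟫).re ≤ (⟪J (σ c), σ c⟫).re := (hNn n _ (hσN c)).2.2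
      _ ≤ ‖⟪J (σ c), σ c⟫‖ := Complex.re_le_norm _
      _ ≤ ‖σ c‖ * ‖σ c‖ := P.form_le _ _
      _ < ‖y‖ ^ 2 := by nlinarith [norm_nonneg (σ c)]
  exact absurd hfin (by simp [m])

end Van

section Sys

variable {X U Y : Type*} [NormedAddCommGroup X] [InnerProductSpace ℂ X] [CompleteSpace X]
  [NormedAddCommGroup U] [InnerProductSpace ℂ U] [CompleteSpace U]
  [NormedAddCommGroup Y] [InnerProductSpace ℂ Y] [CompleteSpace Y]
  {H : Type*} [NormedAddCommGroup H] [InnerProductSpace ℂ H] [CompleteSpace H]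

theorem IsFundamentalSymmetry.sa {J : X →L[ℂ] X} {κ : ℕ} (h : IsFundamentalSymmetry J κ)
    (x y : X) : ⟪J x, y⟫ = ⟪x, J y⟫ := by
  rw [← ContinuousLinearMap.adjoint_inner_right, h.1.adjoint_eq]

theorem IsFundamentalSymmetry.inv {J : X →L[ℂ] X} {κ : ℕ} (h : IsFundamentalSymmetry J κ)
    (x : X) : J (J x) = x := by
  have := congrArg (fun T : X →L[ℂ] X => T x) h.2.1
  simpa using this

theorem iadj_pow_inner {J A : X →L[ℂ] X} (sa : ∀ x y, ⟪J x, y⟫ = ⟪x, J y⟫)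
    (inv : ∀ x, J (J x) = x) (n : ℕ) (v x : X) :
    ⟪((iadj J J A) ^ n) (J v), x⟫ = ⟪v, (A ^ n) (J x)⟫ := by
  induction n generalizing v with
  | zero => exact sa v x
  | succ n ih =>
    have e : ((iadj J J A) ^ (n + 1)) (J v)
        = ((iadj J J A) ^ n) (J (ContinuousLinearMap.adjoint A v)) := by
      rw [pow_succ, mul_apply_eq_comp]
      congr 1
      simp [iadj, inv]
    have e2 : (A ^ (n + 1)) (J x) = A ((A ^ n) (J x)) := by
      rw [pow_succ', mul_apply_eq_comp]
    rw [e, ih, e2, ContinuousLinearMap.adjoint_inner_left]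

theorem obs_iff {J A : X →L[ℂ] X} {C : X →L[ℂ] Y} (sa : ∀ x y, ⟪J x, y⟫ = ⟪x, J y⟫)
    (inv : ∀ x, J (J x) = x) :
    obsSpace J A C = ⊤ ↔ ∀ x, (∀ n : ℕ, C ((A ^ n) x) = 0) → x = 0 := by
  have hmem : ∀ x, x ∈ (⨆ n : ℕ, LinearMap.range
      (((((iadj J J A) ^ n) ∘L (J ∘L ContinuousLinearMap.adjoint C)) : Y →L[ℂ] X) :
        Y →ₗ[ℂ] X))ᗮ ↔ ∀ n : ℕ, C ((A ^ n) (J x)) = 0 := by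
    intro x
    rw [← Submodule.iInf_orthogonal, Submodule.mem_iInf]
    refine forall_congr' fun n => ?_
    rw [Submodule.mem_orthogonal]
    constructor
    · intro h
      have := h _ ⟨C ((A ^ n) (J x)), rfl⟩
      have h2 := iadj_pow_inner (A := A) sa inv n
        (ContinuousLinearMap.adjoint C (C ((A ^ n) (J x)))) x
      rw [ContinuousLinearMap.adjoint_inner_left] at h2
      exact inner_self_eq_zero.1 (h2.symm.trans this)
    · rintro h _ ⟨y, rfl⟩
      have h2 := iadj_pow_inner (A := A) sa inv n (ContinuousLinearMap.adjoint C y) x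
      rw [ContinuousLinearMap.adjoint_inner_left, h, inner_zero_right] at h2
      exact h2
  unfold obsSpace ctrlSpace
  rw [Submodule.topologicalClosure_eq_top_iff, Submodule.eq_bot_iff]
  constructor
  · intro h x hx
    have h1 := h (J x) ((hmem _).2 (by rw [inv]; exact hx))
    rw [← inv x, h1, map_zero]
  · intro h x hx
    have h1 := h (J x) ((hmem _).1 hx)
    rw [← inv x, h1, map_zero]

/-- the resolvent -/
abbrev res (A : X →L[ℂ] X) (z : ℂ) : X →L[ℂ] X := Ring.inverse ((1 : X →L[ℂ] X) - z • A)

theorem res_zero (A : X →L[ℂ] X) : res A 0 = 1 := by simp [res]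

theorem res_eq {A : X →L[ℂ] X} {z : ℂ} (h : IsUnit ((1 : X →L[ℂ] X) - z • A)) (x : X) :
    res A z x = x + z • res A z (A x) := by
  have h1 := Ring.inverse_mul_cancel _ h
  have h2 := congrArg (fun T : X →L[ℂ] X => T x) h1
  simp only [mul_apply_eq_comp, sub_apply, one_apply_eq_self, smul_apply,
    map_sub, map_smul] at h2
  exact sub_eq_iff_eq_add.1 h2

theorem res_eq' {A : X →L[ℂ] X} {z : ℂ} (h : IsUnit ((1 : X →L[ℂ] X) - z • A)) (x : X) :
    res A z x = x + z • A (res A z x) := by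
  have h1 := Ring.mul_inverse_cancel _ h
  have h2 := congrArg (fun T : X →L[ℂ] X => T x) h1
  simp only [mul_apply_eq_comp, sub_apply, one_apply_eq_self,
    smul_apply] at h2
  nth_rewrite 2 [← h2]
  simp

theorem res_cont (A : X →L[ℂ] X) : ContinuousAt (res A) 0 := by
  have h1 : ContinuousAt (fun z : ℂ => (1 : X →L[ℂ] X) - z • A) 0 := by fun_prop
  have h2 := NormedRing.inverse_continuousAt (1 : (X →L[ℂ] X)ˣ)
  have h3 : ContinuousAt Ring.inverse ((1 : X →L[ℂ] X) - (0 : ℂ) • A) := by simpa using h2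
  exact ContinuousAt.comp (f := fun z : ℂ => (1 : X →L[ℂ] X) - z • A) h3 h1

theorem unit_event (A : X →L[ℂ] X) : ∀ᶠ z : ℂ in 𝓝 0, IsUnit ((1 : X →L[ℂ] X) - z • A) := by
  have h1 : ContinuousAt (fun z : ℂ => (1 : X →L[ℂ] X) - z • A) 0 := by fun_prop
  refine h1.eventually (p := IsUnit) ?_
  exact Units.isOpen.mem_nhds (by simp)

theorem obs_res (A : X →L[ℂ] X) (C : X →L[ℂ] Y) (x : X) :
    (∀ n : ℕ, C ((A ^ n) x) = 0) ↔ ∀ᶠ z : ℂ in 𝓝 0, C (res A z x) = 0 := by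
  constructor
  · intro h
    have hsm : ∀ᶠ z : ℂ in 𝓝 0, ‖z‖ * ‖A‖ < 1 := by
      have : ContinuousAt (fun z : ℂ => ‖z‖ * ‖A‖) 0 := by fun_prop
      exact this.eventually (gt_mem_nhds (by simp))
    filter_upwards [unit_event A, hsm] with z hz hlt
    have e : ∀ n : ℕ, C (res A z x) = z ^ n • C (res A z ((A ^ n) x)) := by
      intro n
      induction n with
      | zero => simp
      | succ n ih =>
        have e2 : (A ^ (n + 1)) x = A ((A ^ n) x) := by
          rw [pow_succ', mul_apply_eq_comp]
        rw [ih, res_eq hz, map_add, h n, zero_add, map_smul, smul_smul, ← pow_succ, e2]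
    have hb : ∀ n : ℕ, ‖C (res A z x)‖ ≤ (‖z‖ * ‖A‖) ^ n * (‖C‖ * (‖res A z‖ * ‖x‖)) := by
      intro n
      have hA : ∀ n : ℕ, ‖(A ^ n) x‖ ≤ ‖A‖ ^ n * ‖x‖ := by
        intro n
        induction n with
        | zero => simp
        | succ n ih =>
          rw [pow_succ', mul_apply_eq_comp, pow_succ', mul_assoc]
          exact (A.le_opNorm _).trans (by gcongr)
      rw [e n, norm_smul, norm_pow, mul_pow, mul_assoc]
      gcongr
      calc ‖C (res A z ((A ^ n) x))‖ ≤ ‖C‖ * ‖res A z ((A ^ n) x)‖ := C.le_opNorm _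
        _ ≤ ‖C‖ * (‖res A z‖ * ‖(A ^ n) x‖) := by
            gcongr; exact (res A z).le_opNorm _
        _ ≤ ‖C‖ * (‖res A z‖ * (‖A‖ ^ n * ‖x‖)) := by gcongr; exact hA n
        _ = ‖A‖ ^ n * (‖C‖ * (‖res A z‖ * ‖x‖)) := by ring
    have hl := (tendsto_pow_atTop_nhds_zero_of_lt_one (by positivity) hlt).mul_const
      (‖C‖ * (‖res A z‖ * ‖x‖))
    rw [zero_mul] at hl
    have := ge_of_tendsto' hl hb
    exact norm_le_zero_iff.1 this
  · intro h n
    induction n generalizing x with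
    | zero =>
      have := h.self_of_nhds
      rw [res_zero] at this
      exact this
    | succ n ih =>
      have h0 : C x = 0 := by
        have := h.self_of_nhds
        rw [res_zero] at this
        exact this
      rw [pow_succ, mul_apply_eq_comp]
      apply ih
      have h1 : ∀ᶠ z : ℂ in 𝓝 0, z ≠ 0 → C (res A z (A x)) = 0 := by
        filter_upwards [h, unit_event A] with z hz hu hne
        rw [res_eq hu, map_add, h0, zero_add, map_smul] at hz
        exact (smul_eq_zero.1 hz).resolve_left hne
      have h2 : C (res A 0 (A x)) = 0 := by
        refine ev_eq_zero_of_cont (ev := fun z => C (res A z (A x))) (fun f => ?_)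
          (eventually_nhdsWithin_iff.2 h1)
        have c1 : ContinuousAt (fun z => C (res A z (A x))) 0 :=
          C.continuous.continuousAt.comp ((res_cont A).clm_apply continuousAt_const)
        exact ContinuousAt.inner (𝕜 := ℂ) c1 continuousAt_const
      filter_upwards [h1] with z hz
      by_cases hz0 : z = 0
      · rw [hz0, h2]
      · exact hz hz0

/-- the kernel vectors of a system -/
def sysK (J A : X →L[ℂ] X) (C : X →L[ℂ] Y) (w : ℂ) (f : Y) : X :=
  J (ContinuousLinearMap.adjoint (res A w) (ContinuousLinearMap.adjoint C f))

theorem sysK_inner {J A : X →L[ℂ] X} {C : X →L[ℂ] Y} (sa : ∀ x y, ⟪J x, y⟫ = ⟪x, J y⟫)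
    (inv : ∀ x, J (J x) = x) (w : ℂ) (f : Y) (x : X) :
    ⟪J x, sysK J A C w f⟫ = ⟪C (res A w x), f⟫ := by
  rw [sysK, sa, inv, ContinuousLinearMap.adjoint_inner_right,
    ContinuousLinearMap.adjoint_inner_right]

theorem sysK_eq {J A : X →L[ℂ] X} {C : X →L[ℂ] Y}
    (inv : ∀ x, J (J x) = x) {w : ℂ} (h : IsUnit ((1 : X →L[ℂ] X) - w • A)) (f : Y) :
    iadj J J A (conj w • sysK J A C w f) + (J ∘L ContinuousLinearMap.adjoint C) f
      = sysK J A C w f := by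
  simp only [iadj, sysK, ContinuousLinearMap.comp_apply, map_smul, inv]
  rw [← map_smul, ← map_add]
  congr 1
  refine ext_inner_right ℂ fun x => ?_
  simp only [inner_add_left, inner_smul_left, ContinuousLinearMap.adjoint_inner_left,
    Complex.conj_conj]
  rw [res_eq h x]
  simp only [map_add, map_smul, inner_add_right, inner_smul_right]
  ring

theorem sysK_eq2 {J A : X →L[ℂ] X} {B : U →L[ℂ] X} {C : X →L[ℂ] Y} {D : U →L[ℂ] Y}
    (inv : ∀ x, J (J x) = x) (w : ℂ) (f : Y) :
    (ContinuousLinearMap.adjoint B ∘L J) (conj w • sysK J A C w f)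
      + ContinuousLinearMap.adjoint D f
      = ContinuousLinearMap.adjoint (transferAt A B C D w) f := by
  simp only [sysK, ContinuousLinearMap.comp_apply, map_smul, inv, transferAt]
  refine ext_inner_right ℂ fun x => ?_
  simp only [inner_add_left, inner_smul_left, ContinuousLinearMap.adjoint_inner_left,
    Complex.conj_conj, add_apply, smul_apply, ContinuousLinearMap.comp_apply, inner_add_right,
    inner_smul_right]
  ring

theorem sys_gram {J A : X →L[ℂ] X} {B : U →L[ℂ] X} {C : X →L[ℂ] Y} {D : U →L[ℂ] Y}
    {S : ℂ → (U →L[ℂ] Y)} (inv : ∀ x, J (J x) = x) (co : IsCoisometricSys J A B C D)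
    {w v : ℂ} (hw : IsUnit ((1 : X →L[ℂ] X) - w • A)) (hv : IsUnit ((1 : X →L[ℂ] X) - v • A))
    (hSw : transferAt A B C D w = S w) (hSv : transferAt A B C D v = S v)
    (hw1 : ‖w‖ < 1) (hv1 : ‖v‖ < 1) (f g : Y) :
    ⟪J (sysK J A C w f), sysK J A C v g⟫ = ⟪schurKernel S w v f, g⟫ := by
  have h1 := co (conj w • sysK J A C w f) (conj v • sysK J A C v g) f g
  rw [sysK_eq inv hw, sysK_eq inv hv, sysK_eq2 inv, sysK_eq2 inv, hSw, hSv, map_smul,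
    inner_smul_left, inner_smul_right, Complex.conj_conj] at h1
  have h2 := kernel_id S hw1 hv1 f g
  apply mul_left_cancel₀ (one_sub_ne hw1 hv1)
  rw [h2]
  linear_combination h1

theorem sys_iso {S : ℂ → (U →L[ℂ] Y)} {Ω : Set ℂ} {κ : ℕ} (hS : MemGenSchur S Ω κ)
    {J A : X →L[ℂ] X} {B : U →L[ℂ] X} {C : X →L[ℂ] Y} {D : U →L[ℂ] Y}
    (hJ : IsFundamentalSymmetry J κ) (co : IsCoisometricSys J A B C D)
    (obs : obsSpace J A C = ⊤) (real : IsRealizationOf A B C D S)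
    {JH : H →L[ℂ] H} {ev : H →ₗ[ℂ] (ℂ → Y)} {k : ℂ → Y → H} (h : RK S Ω JH ev k) :
    ∃ V : X ≃ₗ[ℂ] H, ∀ᶠ z in 𝓝 (0 : ℂ), ∀ x, ev (V x) z = C (res A z x) := by
  obtain ⟨ε, hε, hr⟩ := real
  obtain ⟨δ, hδ, hball⟩ := Metric.mem_nhds_iff.1
    (Filter.inter_mem (ball_mem_nhds (0 : ℂ) hε) (hS.isOpen.mem_nhds hS.zero_mem))
  have hΩ' : ball (0 : ℂ) δ ⊆ Ω := fun z hz => (hball hz).2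
  have hr' : ∀ z ∈ ball (0 : ℂ) δ, IsUnit ((1 : X →L[ℂ] X) - z • A) ∧
      transferAt A B C D z = S z := fun z hz => hr z (by simpa using (hball hz).1)
  have nlt : ∀ z ∈ ball (0 : ℂ) δ, ‖z‖ < 1 := fun z hz => by
    simpa using hS.subset (hΩ' hz)
  have gr : ∀ w ∈ ball (0 : ℂ) δ, ∀ v ∈ ball (0 : ℂ) δ, ∀ f g,
      ⟪J (sysK J A C w f), sysK J A C v g⟫ = ⟪schurKernel S w v f, g⟫ :=
    fun w hw v hv f g => sys_gram hJ.inv co (hr' w hw).1 (hr' v hv).1 (hr' w hw).2 (hr' v hv).2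
      (nlt w hw) (nlt v hv) f g
  have tot : ∀ x, (∀ w ∈ ball (0 : ℂ) δ, ∀ f, ⟪J x, sysK J A C w f⟫ = 0) → x = 0 := by
    intro x hx
    refine (obs_iff hJ.sa hJ.inv).1 obs x ((obs_res A C x).2 ?_)
    filter_upwards [ball_mem_nhds (0 : ℂ) hδ] with z hz
    have := hx z hz (C (res A z x))
    rw [sysK_inner hJ.sa hJ.inv] at this
    exact inner_self_eq_zero.1 this
  have PX : Pont J := pont_of_gram hS hΩ' hJ (sysK J A C) gr tot
  obtain ⟨V, hV, -⟩ := exists_iso (k := fun a : ball (0 : ℂ) δ × Y => k a.1 a.2)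
    (k' := fun a : ball (0 : ℂ) δ × Y => sysK J A C a.1 a.2) h.pont PX
    (fun x hx => by
      refine h.van hS.isOpen hS.zero_mem hS.subset hS.holo.continuousOn x ?_
      filter_upwards [ball_mem_nhds (0 : ℂ) hδ] with z hz
      have := hx (⟨z, hz⟩, ev x z)
      rw [h.repro z (hΩ' hz)] at this
      exact inner_self_eq_zero.1 this)
    (fun x hx => tot x fun w hw f => hx (⟨w, hw⟩, f))
    (fun a b => by rw [h.gram (hΩ' a.1.2) (hΩ' b.1.2), gr _ a.1.2 _ b.1.2])
  refine ⟨V, ?_⟩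
  filter_upwards [ball_mem_nhds (0 : ℂ) hδ] with z hz x
  refine ext_inner_right ℂ fun f => ?_
  rw [← h.repro z (hΩ' hz), ← sysK_inner hJ.sa hJ.inv]
  exact hV x (⟨z, hz⟩, f)

end Sys

section ProdSys

variable {U Y₁ Y X₁ X₂ : Type*} [NormedAddCommGroup U] [InnerProductSpace ℂ U] [CompleteSpace U]
  [NormedAddCommGroup Y₁] [InnerProductSpace ℂ Y₁] [CompleteSpace Y₁]
  [NormedAddCommGroup Y] [InnerProductSpace ℂ Y] [CompleteSpace Y]
  [NormedAddCommGroup X₁] [InnerProductSpace ℂ X₁] [CompleteSpace X₁]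
  [NormedAddCommGroup X₂] [InnerProductSpace ℂ X₂] [CompleteSpace X₂]

theorem prodA_fst (A₁ : X₁ →L[ℂ] X₁) (C₁ : X₁ →L[ℂ] Y₁) (A₂ : X₂ →L[ℂ] X₂) (B₂ : Y₁ →L[ℂ] X₂)
    (x : ProdState X₁ X₂) : (prodA A₁ C₁ A₂ B₂ x).fst = A₁ x.fst := rfl

theorem prodA_snd (A₁ : X₁ →L[ℂ] X₁) (C₁ : X₁ →L[ℂ] Y₁) (A₂ : X₂ →L[ℂ] X₂) (B₂ : Y₁ →L[ℂ] X₂)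
    (x : ProdState X₁ X₂) : (prodA A₁ C₁ A₂ B₂ x).snd = B₂ (C₁ x.fst) + A₂ x.snd := rfl

theorem prodB_fst (B₁ : U →L[ℂ] X₁) (D₁ : U →L[ℂ] Y₁) (B₂ : Y₁ →L[ℂ] X₂) (u : U) :
    (prodB B₁ D₁ B₂ u).fst = B₁ u := rfl

theorem prodB_snd (B₁ : U →L[ℂ] X₁) (D₁ : U →L[ℂ] Y₁) (B₂ : Y₁ →L[ℂ] X₂) (u : U) :
    (prodB B₁ D₁ B₂ u).snd = B₂ (D₁ u) := rfl

theorem prodC_apply (C₁ : X₁ →L[ℂ] Y₁) (C₂ : X₂ →L[ℂ] Y) (D₂ : Y₁ →L[ℂ] Y)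
    (x : ProdState X₁ X₂) : prodC C₁ C₂ D₂ x = D₂ (C₁ x.fst) + C₂ x.snd := rfl

theorem prodA_adj (A₁ : X₁ →L[ℂ] X₁) (C₁ : X₁ →L[ℂ] Y₁) (A₂ : X₂ →L[ℂ] X₂) (B₂ : Y₁ →L[ℂ] X₂)
    (x : ProdState X₁ X₂) : ContinuousLinearMap.adjoint (prodA A₁ C₁ A₂ B₂) x
      = WithLp.toLp 2 (ContinuousLinearMap.adjoint A₁ x.fst
          + ContinuousLinearMap.adjoint C₁ (ContinuousLinearMap.adjoint B₂ x.snd),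
        ContinuousLinearMap.adjoint A₂ x.snd) := by
  refine ext_inner_right ℂ fun y => ?_
  rw [ContinuousLinearMap.adjoint_inner_left, WithLp.prod_inner_apply, WithLp.prod_inner_apply]
  change ⟪x.fst, A₁ y.fst⟫ + ⟪x.snd, B₂ (C₁ y.fst) + A₂ y.snd⟫ = ⟪ContinuousLinearMap.adjoint A₁ x.fst
          + ContinuousLinearMap.adjoint C₁ (ContinuousLinearMap.adjoint B₂ x.snd), y.fst⟫
          + ⟪ContinuousLinearMap.adjoint A₂ x.snd, y.snd⟫
  simp only [inner_add_left, inner_add_right, ContinuousLinearMap.adjoint_inner_left]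
  ring

theorem prodC_adj (C₁ : X₁ →L[ℂ] Y₁) (C₂ : X₂ →L[ℂ] Y) (D₂ : Y₁ →L[ℂ] Y) (y : Y) :
    ContinuousLinearMap.adjoint (prodC C₁ C₂ D₂) y
      = WithLp.toLp 2 (ContinuousLinearMap.adjoint C₁ (ContinuousLinearMap.adjoint D₂ y),
        ContinuousLinearMap.adjoint C₂ y) := by
  refine ext_inner_right ℂ fun x => ?_
  rw [ContinuousLinearMap.adjoint_inner_left, WithLp.prod_inner_apply, prodC_apply]
  change _ = ⟪ContinuousLinearMap.adjoint C₁ (ContinuousLinearMap.adjoint D₂ y), x.fst⟫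
    + ⟪ContinuousLinearMap.adjoint C₂ y, x.snd⟫
  simp only [inner_add_right, ContinuousLinearMap.adjoint_inner_left]

theorem prodB_adj (B₁ : U →L[ℂ] X₁) (D₁ : U →L[ℂ] Y₁) (B₂ : Y₁ →L[ℂ] X₂) (x : ProdState X₁ X₂) :
    ContinuousLinearMap.adjoint (prodB B₁ D₁ B₂) x
      = ContinuousLinearMap.adjoint B₁ x.fst
        + ContinuousLinearMap.adjoint D₁ (ContinuousLinearMap.adjoint B₂ x.snd) := by
  refine ext_inner_right ℂ fun u => ?_
  rw [ContinuousLinearMap.adjoint_inner_left, WithLp.prod_inner_apply]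
  change ⟪x.fst, B₁ u⟫ + ⟪x.snd, B₂ (D₁ u)⟫ = _
  simp only [inner_add_left, ContinuousLinearMap.adjoint_inner_left]

theorem prod_coiso {J₁ : X₁ →L[ℂ] X₁} {J₂ : X₂ →L[ℂ] X₂}
    {A₁ : X₁ →L[ℂ] X₁} {B₁ : U →L[ℂ] X₁} {C₁ : X₁ →L[ℂ] Y₁} {D₁ : U →L[ℂ] Y₁}
    {A₂ : X₂ →L[ℂ] X₂} {B₂ : Y₁ →L[ℂ] X₂} {C₂ : X₂ →L[ℂ] Y} {D₂ : Y₁ →L[ℂ] Y}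
    (h1 : IsCoisometricSys J₁ A₁ B₁ C₁ D₁) (h2 : IsCoisometricSys J₂ A₂ B₂ C₂ D₂) :
    IsCoisometricSys (prodJ J₁ J₂) (prodA A₁ C₁ A₂ B₂) (prodB B₁ D₁ B₂) (prodC C₁ C₂ D₂)
        (prodD D₁ D₂) := by
  intro x x' y y'
  let u : ProdState X₁ X₂ → Y → Y₁ := fun x y =>
    (ContinuousLinearMap.adjoint B₂ ∘L J₂) x.snd + ContinuousLinearMap.adjoint D₂ y
  have e1 : ∀ (x : ProdState X₁ X₂) (y : Y),
      iadj (prodJ J₁ J₂) (prodJ J₁ J₂) (prodA A₁ C₁ A₂ B₂) x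
        + (prodJ J₁ J₂ ∘L ContinuousLinearMap.adjoint (prodC C₁ C₂ D₂)) y
      = WithLp.toLp 2 (iadj J₁ J₁ A₁ x.fst + (J₁ ∘L ContinuousLinearMap.adjoint C₁) (u x y),
          iadj J₂ J₂ A₂ x.snd + (J₂ ∘L ContinuousLinearMap.adjoint C₂) y) := by
    intro x y
    simp only [iadj, ContinuousLinearMap.comp_apply, prodA_adj, prodC_adj, u]
    refine prodState_ext ?_ ?_
    · change J₁ (ContinuousLinearMap.adjoint A₁ (J₁ x.fst)
          + ContinuousLinearMap.adjoint C₁ (ContinuousLinearMap.adjoint B₂ (J₂ x.snd)))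
          + J₁ (ContinuousLinearMap.adjoint C₁ (ContinuousLinearMap.adjoint D₂ y)) = _
      simp only [map_add, WithLp.toLp_fst, add_assoc]
    · rfl
  have e2 : ∀ (x : ProdState X₁ X₂) (y : Y),
      (ContinuousLinearMap.adjoint (prodB B₁ D₁ B₂) ∘L prodJ J₁ J₂) x
        + ContinuousLinearMap.adjoint (prodD D₁ D₂) y
      = (ContinuousLinearMap.adjoint B₁ ∘L J₁) x.fst + ContinuousLinearMap.adjoint D₁ (u x y) := by
    intro x y
    simp only [ContinuousLinearMap.comp_apply, prodB_adj, prodJ_fst, prodJ_snd, prodD,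
      ContinuousLinearMap.adjoint_comp, u, map_add, add_assoc]
  rw [e1, e1, e2, e2, prodJ_form, prodJ_form]
  simp only [WithLp.toLp_fst, WithLp.toLp_snd]
  have a1 := h1 x.fst x'.fst (u x y) (u x' y')
  have a2 := h2 x.snd x'.snd y y'
  change _ + ⟪u x y, u x' y'⟫ = _ at a2
  linear_combination a1 + a2

theorem prod_res {A₁ : X₁ →L[ℂ] X₁} {C₁ : X₁ →L[ℂ] Y₁} {A₂ : X₂ →L[ℂ] X₂} {B₂ : Y₁ →L[ℂ] X₂}
    {z : ℂ} (h1 : IsUnit ((1 : X₁ →L[ℂ] X₁) - z • A₁))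
    (h2 : IsUnit ((1 : X₂ →L[ℂ] X₂) - z • A₂)) :
    IsUnit ((1 : ProdState X₁ X₂ →L[ℂ] ProdState X₁ X₂) - z • prodA A₁ C₁ A₂ B₂) ∧
      ∀ x, res (prodA A₁ C₁ A₂ B₂) z x = WithLp.toLp 2 (res A₁ z x.fst,
        res A₂ z (x.snd + z • B₂ (C₁ (res A₁ z x.fst)))) := by
  let Q : ProdState X₁ X₂ →L[ℂ] ProdState X₁ X₂ :=
    eP.symm.toContinuousLinearMap ∘L
      (((res A₁ z) ∘L fst ℂ X₁ X₂).prod ((res A₂ z) ∘L (snd ℂ X₁ X₂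
        + z • (B₂ ∘L C₁ ∘L (res A₁ z) ∘L fst ℂ X₁ X₂)))) ∘L eP.toContinuousLinearMap
  have hQ : ∀ x, Q x = WithLp.toLp 2 (res A₁ z x.fst,
        res A₂ z (x.snd + z • B₂ (C₁ (res A₁ z x.fst)))) := fun x => rfl
  have hl : ((1 : ProdState X₁ X₂ →L[ℂ] ProdState X₁ X₂) - z • prodA A₁ C₁ A₂ B₂) * Q = 1 := by
    ext1 x
    rw [mul_apply_eq_comp, sub_apply, smul_apply, one_apply_eq_self, one_apply_eq_self, hQ]
    refine prodState_ext ?_ ?_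
    · change res A₁ z x.fst - z • A₁ (res A₁ z x.fst) = x.fst
      exact sub_eq_iff_eq_add.2 (res_eq' h1 _)
    · change res A₂ z (x.snd + z • B₂ (C₁ (res A₁ z x.fst)))
        - z • (B₂ (C₁ (res A₁ z x.fst))
          + A₂ (res A₂ z (x.snd + z • B₂ (C₁ (res A₁ z x.fst))))) = x.snd
      have := res_eq' h2 (x.snd + z • B₂ (C₁ (res A₁ z x.fst)))
      rw [smul_add, sub_eq_iff_eq_add, ← add_assoc]
      exact this
  have hr : Q * ((1 : ProdState X₁ X₂ →L[ℂ] ProdState X₁ X₂) - z • prodA A₁ C₁ A₂ B₂) = 1 := by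
    ext1 x
    rw [mul_apply_eq_comp, sub_apply, smul_apply, one_apply_eq_self, hQ]
    have e1 : res A₁ z (x.fst - z • A₁ x.fst) = x.fst := by
      rw [map_sub, map_smul]
      exact sub_eq_iff_eq_add.2 (res_eq h1 _)
    refine prodState_ext e1 ?_
    change res A₂ z ((x.snd - z • (B₂ (C₁ x.fst) + A₂ x.snd))
      + z • B₂ (C₁ (res A₁ z (x.fst - z • A₁ x.fst)))) = x.snd
    rw [e1, smul_add, ← sub_sub, sub_right_comm, sub_add_cancel, map_sub, map_smul]
    exact sub_eq_iff_eq_add.2 (res_eq h2 _)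
  refine ⟨⟨⟨_, Q, hl, hr⟩, rfl⟩, fun x => ?_⟩
  have : res (prodA A₁ C₁ A₂ B₂) z = Q := Ring.inverse_unit ⟨_, Q, hl, hr⟩
  rw [this, hQ]

theorem prod_CR {A₁ : X₁ →L[ℂ] X₁} {C₁ : X₁ →L[ℂ] Y₁} {A₂ : X₂ →L[ℂ] X₂} {B₂ : Y₁ →L[ℂ] X₂}
    {C₂ : X₂ →L[ℂ] Y} {D₂ : Y₁ →L[ℂ] Y}
    {z : ℂ} (h1 : IsUnit ((1 : X₁ →L[ℂ] X₁) - z • A₁))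
    (h2 : IsUnit ((1 : X₂ →L[ℂ] X₂) - z • A₂)) (x : ProdState X₁ X₂) :
    prodC C₁ C₂ D₂ (res (prodA A₁ C₁ A₂ B₂) z x)
      = transferAt A₂ B₂ C₂ D₂ z (C₁ (res A₁ z x.fst)) + C₂ (res A₂ z x.snd) := by
  rw [(prod_res h1 h2).2, prodC_apply]
  simp only [WithLp.toLp_fst, WithLp.toLp_snd, transferAt, add_apply, smul_apply,
    ContinuousLinearMap.comp_apply, map_add, map_smul]
  abel

theorem prod_real {A₁ : X₁ →L[ℂ] X₁} {B₁ : U →L[ℂ] X₁} {C₁ : X₁ →L[ℂ] Y₁} {D₁ : U →L[ℂ] Y₁}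
    {A₂ : X₂ →L[ℂ] X₂} {B₂ : Y₁ →L[ℂ] X₂} {C₂ : X₂ →L[ℂ] Y} {D₂ : Y₁ →L[ℂ] Y}
    {S₁ : ℂ → (U →L[ℂ] Y₁)} {S₂ : ℂ → (Y₁ →L[ℂ] Y)}
    (h1 : IsRealizationOf A₁ B₁ C₁ D₁ S₁) (h2 : IsRealizationOf A₂ B₂ C₂ D₂ S₂) :
    IsRealizationOf (prodA A₁ C₁ A₂ B₂) (prodB B₁ D₁ B₂) (prodC C₁ C₂ D₂) (prodD D₁ D₂)
        (fun z => S₂ z ∘L S₁ z) := by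
  obtain ⟨ε₁, p1, r1⟩ := h1
  obtain ⟨ε₂, p2, r2⟩ := h2
  refine ⟨min ε₁ ε₂, lt_min p1 p2, fun z hz => ?_⟩
  obtain ⟨u1, t1⟩ := r1 z (hz.trans_le (min_le_left _ _))
  obtain ⟨u2, t2⟩ := r2 z (hz.trans_le (min_le_right _ _))
  refine ⟨(prod_res u1 u2).1, ?_⟩
  ext1 u
  have e := prod_CR (C₁ := C₁) (B₂ := B₂) (C₂ := C₂) (D₂ := D₂) u1 u2 (prodB B₁ D₁ B₂ u)
  rw [prodB_fst, prodB_snd] at e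
  have f1 : transferAt (prodA A₁ C₁ A₂ B₂) (prodB B₁ D₁ B₂) (prodC C₁ C₂ D₂) (prodD D₁ D₂) z u
      = D₂ (D₁ u) + z • prodC C₁ C₂ D₂ (res (prodA A₁ C₁ A₂ B₂) z (prodB B₁ D₁ B₂ u)) := rfl
  have f2 : transferAt A₂ B₂ C₂ D₂ z (D₁ u) = D₂ (D₁ u) + z • C₂ (res A₂ z (B₂ (D₁ u))) := rfl
  have f3 : transferAt A₁ B₁ C₁ D₁ z u = D₁ u + z • C₁ (res A₁ z (B₁ u)) := rfl
  rw [f1, e]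
  change _ = S₂ z (S₁ z u)
  rw [← t1, ← t2, f3, map_add, f2, map_smul, smul_add]
  abel

end ProdSys

section ProdRK

variable {U Y₁ Y H1 H2 : Type*} [NormedAddCommGroup U] [InnerProductSpace ℂ U] [CompleteSpace U]
  [NormedAddCommGroup Y₁] [InnerProductSpace ℂ Y₁] [CompleteSpace Y₁]
  [NormedAddCommGroup Y] [InnerProductSpace ℂ Y] [CompleteSpace Y]
  [NormedAddCommGroup H1] [InnerProductSpace ℂ H1] [CompleteSpace H1]
  [NormedAddCommGroup H2] [InnerProductSpace ℂ H2] [CompleteSpace H2]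

/-- evaluation on the product space. -/
def prodEv (S₂ : ℂ → (Y₁ →L[ℂ] Y)) (ev1 : H1 →ₗ[ℂ] (ℂ → Y₁)) (ev2 : H2 →ₗ[ℂ] (ℂ → Y)) :
    ProdState H1 H2 →ₗ[ℂ] (ℂ → Y) where
  toFun p z := S₂ z (ev1 p.fst z) + ev2 p.snd z
  map_add' p q := by
    ext z
    simp only [WithLp.add_fst, WithLp.add_snd, map_add, Pi.add_apply]
    abel
  map_smul' c p := by
    ext z
    simp

theorem prodEv_apply (S₂ : ℂ → (Y₁ →L[ℂ] Y)) (ev1 : H1 →ₗ[ℂ] (ℂ → Y₁)) (ev2 : H2 →ₗ[ℂ] (ℂ → Y))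
    (p : ProdState H1 H2) (z : ℂ) :
    prodEv S₂ ev1 ev2 p z = S₂ z (ev1 p.fst z) + ev2 p.snd z := rfl

theorem prodRK {S₁ : ℂ → (U →L[ℂ] Y₁)} {S₂ : ℂ → (Y₁ →L[ℂ] Y)} {Ω : Set ℂ}
    {JH1 : H1 →L[ℂ] H1} {ev1 : H1 →ₗ[ℂ] (ℂ → Y₁)} {k1 : ℂ → Y₁ → H1}
    {JH2 : H2 →L[ℂ] H2} {ev2 : H2 →ₗ[ℂ] (ℂ → Y)} {k2 : ℂ → Y → H2}
    (h1 : RK S₁ Ω JH1 ev1 k1) (h2 : RK S₂ Ω JH2 ev2 k2)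
    (inj : ∀ p, (∀ z ∈ Ω, prodEv S₂ ev1 ev2 p z = 0) → p = 0) :
    RK (fun z => S₂ z ∘L S₁ z) Ω (prodJ JH1 JH2) (prodEv S₂ ev1 ev2)
      (fun w f => WithLp.toLp 2 (k1 w (ContinuousLinearMap.adjoint (S₂ w) f), k2 w f)) where
  pont := h1.pont.prod h2.pont
  repro w hw f p := by
    rw [prodJ_form, prodEv_apply, inner_add_left]
    simp only [WithLp.toLp_fst, WithLp.toLp_snd]
    rw [h1.repro w hw, h2.repro w hw, ContinuousLinearMap.adjoint_inner_right]
  evk w hw f z hz := by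
    rw [prodEv_apply]
    simp only [WithLp.toLp_fst, WithLp.toLp_snd]
    rw [h1.evk w hw _ z hz, h2.evk w hw _ z hz]
    simp only [schurKernel, smul_apply, map_smul, sub_apply, one_apply_eq_self,
      ContinuousLinearMap.comp_apply, map_sub, ContinuousLinearMap.adjoint_comp, ← smul_add]
    congr 1
    abel
  sep := inj

end ProdRK

/-- the product of co-isometric observable realizations is a co-isometric
observable realization of `S = S₂S₁` iff `H(S) = S₂·H(S₁) ⊕ H(S₂)` and multiplication by
`S₂` is an isometry of `H(S₁)` into `H(S)`. -/
theorem coisometric_observable_product_iff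
    {U Y₁ Y X₁ X₂ H1 H2 HS : Type*}
    [NormedAddCommGroup U] [InnerProductSpace ℂ U] [CompleteSpace U] [NormedAddCommGroup Y₁] [InnerProductSpace ℂ Y₁] [CompleteSpace Y₁] [NormedAddCommGroup Y] [InnerProductSpace ℂ Y] [CompleteSpace Y] [NormedAddCommGroup X₁] [InnerProductSpace ℂ X₁] [CompleteSpace X₁] [NormedAddCommGroup X₂] [InnerProductSpace ℂ X₂] [CompleteSpace X₂]
    [NormedAddCommGroup H1] [InnerProductSpace ℂ H1] [CompleteSpace H1] [NormedAddCommGroup H2] [InnerProductSpace ℂ H2] [CompleteSpace H2] [NormedAddCommGroup HS] [InnerProductSpace ℂ HS] [CompleteSpace HS]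
    (κ₁ κ₂ κS : ℕ)
    (S₁ : ℂ → (U →L[ℂ] Y₁)) (S₂ : ℂ → (Y₁ →L[ℂ] Y)) (Ω : Set ℂ)
    (hS₁ : MemGenSchur S₁ Ω κ₁) (hS₂ : MemGenSchur S₂ Ω κ₂)
    (hS : MemGenSchur (fun z => S₂ z ∘L S₁ z) Ω κS)
    (J₁ : X₁ →L[ℂ] X₁) (J₂ : X₂ →L[ℂ] X₂)
    (hJ₁ : IsFundamentalSymmetry J₁ κ₁) (hJ₂ : IsFundamentalSymmetry J₂ κ₂)
    (A₁ : X₁ →L[ℂ] X₁) (B₁ : U →L[ℂ] X₁) (C₁ : X₁ →L[ℂ] Y₁) (D₁ : U →L[ℂ] Y₁)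
    (A₂ : X₂ →L[ℂ] X₂) (B₂ : Y₁ →L[ℂ] X₂) (C₂ : X₂ →L[ℂ] Y) (D₂ : Y₁ →L[ℂ] Y)
    (h1co : IsCoisometricSys J₁ A₁ B₁ C₁ D₁) (h1obs : obsSpace J₁ A₁ C₁ = ⊤)
    (h1real : IsRealizationOf A₁ B₁ C₁ D₁ S₁)
    (h2co : IsCoisometricSys J₂ A₂ B₂ C₂ D₂) (h2obs : obsSpace J₂ A₂ C₂ = ⊤)
    (h2real : IsRealizationOf A₂ B₂ C₂ D₂ S₂)
    (JH1 : H1 →L[ℂ] H1) (ev1 : H1 →ₗ[ℂ] (ℂ → Y₁)) (hH1 : IsRKPS S₁ Ω κ₁ JH1 ev1)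
    (JH2 : H2 →L[ℂ] H2) (ev2 : H2 →ₗ[ℂ] (ℂ → Y)) (hH2 : IsRKPS S₂ Ω κ₂ JH2 ev2)
    (JHS : HS →L[ℂ] HS) (evS : HS →ₗ[ℂ] (ℂ → Y))
    (hHS : IsRKPS (fun z => S₂ z ∘L S₁ z) Ω κS JHS evS) :
    (IsCoisometricSys (prodJ J₁ J₂) (prodA A₁ C₁ A₂ B₂) (prodB B₁ D₁ B₂) (prodC C₁ C₂ D₂)
        (prodD D₁ D₂) ∧
      obsSpace (prodJ J₁ J₂) (prodA A₁ C₁ A₂ B₂) (prodC C₁ C₂ D₂) = ⊤ ∧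
      IsRealizationOf (prodA A₁ C₁ A₂ B₂) (prodB B₁ D₁ B₂) (prodC C₁ C₂ D₂) (prodD D₁ D₂)
        (fun z => S₂ z ∘L S₁ z)) ↔
    (((∀ g : HS, ∃! p : H1 × H2, ∀ z ∈ Ω, evS g z = S₂ z (ev1 p.1 z) + ev2 p.2 z) ∧
      (∀ h₂ : H2, ∃ g : HS, ∀ z ∈ Ω, evS g z = ev2 h₂ z) ∧
      (∀ (h₂ h₂' : H2) (g g' : HS), (∀ z ∈ Ω, evS g z = ev2 h₂ z) →
        (∀ z ∈ Ω, evS g' z = ev2 h₂' z) → ⟪JHS g, g'⟫ = ⟪JH2 h₂, h₂'⟫) ∧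
      (∀ (h₁ : H1) (h₂ : H2) (g g' : HS), (∀ z ∈ Ω, evS g z = S₂ z (ev1 h₁ z)) →
        (∀ z ∈ Ω, evS g' z = ev2 h₂ z) → ⟪JHS g, g'⟫ = 0)) ∧
     ((∀ h₁ : H1, ∃ g : HS, ∀ z ∈ Ω, evS g z = S₂ z (ev1 h₁ z)) ∧
      (∀ (h₁ h₁' : H1) (g g' : HS), (∀ z ∈ Ω, evS g z = S₂ z (ev1 h₁ z)) →
        (∀ z ∈ Ω, evS g' z = S₂ z (ev1 h₁' z)) → ⟪JHS g, g'⟫ = ⟪JH1 h₁, h₁'⟫))) := by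
  classical
  obtain ⟨k1, hk1⟩ := hH1.rk hS₁
  obtain ⟨k2, hk2⟩ := hH2.rk hS₂
  obtain ⟨kS, hkS⟩ := hHS.rk hS
  obtain ⟨V1, hV1⟩ := sys_iso hS₁ hJ₁ h1co h1obs h1real hk1
  obtain ⟨V2, hV2⟩ := sys_iso hS₂ hJ₂ h2co h2obs h2real hk2
  have psa : ∀ x y, ⟪prodJ J₁ J₂ x, y⟫ = ⟪x, prodJ J₁ J₂ y⟫ := fun x y => by
    rw [prodJ_form, WithLp.prod_inner_apply, hJ₁.sa, hJ₂.sa]; rfl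
  have pinv : ∀ x, prodJ J₁ J₂ (prodJ J₁ J₂ x) = x := fun x =>
    prodState_ext (hJ₁.inv _) (hJ₂.inv _)
  -- the observation map of the product system, transported to the function spaces
  have hobs : ∀ᶠ z in 𝓝 (0 : ℂ), ∀ x : ProdState X₁ X₂,
      prodC C₁ C₂ D₂ (res (prodA A₁ C₁ A₂ B₂) z x)
        = prodEv S₂ ev1 ev2 (WithLp.toLp 2 (V1 x.fst, V2 x.snd)) z := by
    obtain ⟨ε₂, p2, r2⟩ := h2real
    filter_upwards [hV1, hV2, unit_event A₁, unit_event A₂, ball_mem_nhds (0 : ℂ) p2]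
      with z e1 e2 u1 u2 hz x
    rw [prod_CR u1 u2, (r2 z (by simpa using hz)).2, prodEv_apply]
    simp only [WithLp.toLp_fst, WithLp.toLp_snd]
    rw [e1, e2]
  have key1 : obsSpace (prodJ J₁ J₂) (prodA A₁ C₁ A₂ B₂) (prodC C₁ C₂ D₂) = ⊤ ↔
      ∀ p : ProdState H1 H2, (∀ z ∈ Ω, prodEv S₂ ev1 ev2 p z = 0) → p = 0 := by
    rw [obs_iff psa pinv]
    constructor
    · intro h p hp
      let x : ProdState X₁ X₂ := WithLp.toLp 2 (V1.symm p.fst, V2.symm p.snd)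
      have hx : x = 0 := by
        refine h x ((obs_res _ _ x).2 ?_)
        filter_upwards [hobs, hS₁.isOpen.mem_nhds hS₁.zero_mem] with z e hz
        rw [e]
        have : (WithLp.toLp 2 (V1 x.fst, V2 x.snd) : ProdState H1 H2) = p :=
          prodState_ext (V1.apply_symm_apply _) (V2.apply_symm_apply _)
        rw [this, hp z hz]
      have h1 : V1.symm p.fst = 0 := congrArg WithLp.fst hx
      have h2 : V2.symm p.snd = 0 := congrArg WithLp.snd hx
      exact prodState_ext (V1.symm.map_eq_zero_iff.1 h1) (V2.symm.map_eq_zero_iff.1 h2)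
    · intro inj x hx
      have hp := (prodRK hk1 hk2 inj).van hS.isOpen hS.zero_mem hS.subset hS.holo.continuousOn
        (WithLp.toLp 2 (V1 x.fst, V2 x.snd)) (by
          filter_upwards [hobs, (obs_res _ _ x).1 hx] with z e hz
          rw [← e, hz])
      have h1 : V1 x.fst = 0 := congrArg WithLp.fst hp
      have h2 : V2 x.snd = 0 := congrArg WithLp.snd hp
      exact prodState_ext (V1.map_eq_zero_iff.1 h1) (V2.map_eq_zero_iff.1 h2)
  constructor
  · rintro ⟨-, hO, -⟩
    have inj := key1.1 hO
    have hP := prodRK hk1 hk2 inj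
    obtain ⟨V, hV, hViso⟩ := exists_iso (k := fun a : Ω × Y => kS a.1 a.2)
      (k' := fun a : Ω × Y => (WithLp.toLp 2
        (k1 a.1 (ContinuousLinearMap.adjoint (S₂ a.1) a.2), k2 a.1 a.2) : ProdState H1 H2))
      hkS.pont hP.pont
      (fun x hx => hkS.tot x fun w hw f => hx (⟨w, hw⟩, f))
      (fun x hx => hP.tot x fun w hw f => hx (⟨w, hw⟩, f))
      (fun a b => by
        rw [hkS.gram a.1.2 b.1.2]
        exact (hP.gram a.1.2 b.1.2 _ _).symm)
    have hVev : ∀ p, ∀ z ∈ Ω, evS (V p) z = prodEv S₂ ev1 ev2 p z := by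
      intro p z hz
      refine ext_inner_right ℂ fun f => ?_
      rw [← hkS.repro z hz, ← hP.repro z hz]
      exact hV p (⟨z, hz⟩, f)
    have hVu : ∀ (g : HS) (p : ProdState H1 H2),
        (∀ z ∈ Ω, evS g z = prodEv S₂ ev1 ev2 p z) → g = V p := by
      intro g p h
      rw [← sub_eq_zero]
      apply hkS.sep
      intro z hz
      rw [map_sub, Pi.sub_apply, h z hz, hVev p z hz, sub_self]
    let i1 : H1 → ProdState H1 H2 := fun h => WithLp.toLp 2 (h, 0)
    let i2 : H2 → ProdState H1 H2 := fun h => WithLp.toLp 2 (0, h)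
    have hi1 : ∀ h z, prodEv S₂ ev1 ev2 (i1 h) z = S₂ z (ev1 h z) := fun h z => by
      simp [prodEv_apply, i1]
    have hi2 : ∀ h z, prodEv S₂ ev1 ev2 (i2 h) z = ev2 h z := fun h z => by
      simp [prodEv_apply, i2]
    have g1 : ∀ h (g : HS), (∀ z ∈ Ω, evS g z = S₂ z (ev1 h z)) → g = V (i1 h) :=
      fun h g hg => hVu g _ fun z hz => by rw [hi1, hg z hz]
    have g2 : ∀ h (g : HS), (∀ z ∈ Ω, evS g z = ev2 h z) → g = V (i2 h) :=
      fun h g hg => hVu g _ fun z hz => by rw [hi2, hg z hz]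
    refine ⟨⟨?_, ?_, ?_, ?_⟩, ?_, ?_⟩
    · intro g
      refine ⟨((V.symm g).fst, (V.symm g).snd), fun z hz => ?_, ?_⟩
      · have := hVev (V.symm g) z hz
        rw [V.apply_symm_apply] at this
        exact this
      · rintro ⟨a, b⟩ hab
        have h1 := hVu g (WithLp.toLp 2 (a, b)) hab
        rw [h1, V.symm_apply_apply]
        rfl
    · exact fun h => ⟨V (i2 h), fun z hz => by rw [hVev _ z hz, hi2]⟩
    · intro h h' g g' e e'
      rw [g2 h g e, g2 h' g' e', hViso, prodJ_form]
      simp [i2]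
    · intro h h' g g' e e'
      rw [g1 h g e, g2 h' g' e', hViso, prodJ_form]
      simp [i1, i2]
    · exact fun h => ⟨V (i1 h), fun z hz => by rw [hVev _ z hz, hi1]⟩
    · intro h h' g g' e e'
      rw [g1 h g e, g1 h' g' e', hViso, prodJ_form]
      simp [i1]
  · rintro ⟨⟨hu, -⟩, -⟩
    refine ⟨prod_coiso h1co h2co, key1.2 ?_, prod_real h1real h2real⟩
    intro p hp
    obtain ⟨q, -, hq⟩ := hu 0
    have a := hq (p.fst, p.snd) (fun z hz => by
      have := hp z hz
      rw [prodEv_apply] at this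
      rw [map_zero, Pi.zero_apply]
      exact this.symm)
    have b := hq (0, 0) (fun z hz => by simp)
    have c := a.trans b.symm
    exact prodState_ext (congrArg Prod.fst c) (congrArg Prod.snd c)

end Pontryagin
end
end
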